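/- arXiv:0812.1289 — 2 statements merged into one kernel-verified Lean document; each statement's English description precedes it below -/
import Mathlib

section
/- Let R be a commutative noetherian ring, let a and b be ideals of R, and let M be a finitely generated R-module such that (a+b)M ≠ M. Then H^{cd(a,M)+cd(b,M)}_{a+b}(M) ≅ H^{cd(a,M)}_a(H^{cd(b,M)}_b(M)). -/
open CategoryTheory

/-- The cohomological dimension `cd(a, X) = sup {i | H^i_a(X) ≠ 0}` of an `R`-module `X`
with respect to an ideal `a`. -/
noncomputable def cohDim {R : Type} [CommRing R] (a : Ideal R) (X : ModuleCat R) : ℕ :=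
  sSup {i : ℕ | Nontrivial ((localCohomology a i).obj X)}


namespace LC
open CategoryTheory.Abelian

variable {R : Type} [CommRing R]

/-- The module `R/a^n`. -/
abbrev Q (a : Ideal R) (n : ℕ) : ModuleCat.{0} R := ModuleCat.of R (R ⧸ a ^ n)

/-- The projection between quotients. -/
noncomputable def pr {I J : Ideal R} (h : I ≤ J) :
    ModuleCat.of R (R ⧸ I) ⟶ ModuleCat.of R (R ⧸ J) :=
  ModuleCat.ofHom (Submodule.mapQ _ _ LinearMap.id h)

lemma pr_comp {I J K : Ideal R} (h : I ≤ J) (h' : J ≤ K) : pr h ≫ pr h' = pr (h.trans h') := by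
  ext
  rfl

lemma pr_refl {I : Ideal R} (h : I ≤ I) : pr h = 𝟙 _ := by
  ext
  rfl

/-- transition map on Ext -/
noncomputable def tr (a : Ideal R) (X : ModuleCat.{0} R) (i : ℕ) (m n : ℕ) (h : m ≤ n) :
    Ext (Q a m) X i →ₗ[R] Ext (Q a n) X i :=
  (Ext.mk₀ (pr (Ideal.pow_le_pow_right h))).precompOfLinear R X (zero_add i)

lemma tr_apply (a : Ideal R) (X : ModuleCat.{0} R) (i : ℕ) (m n : ℕ) (h : m ≤ n)
    (x : Ext (Q a m) X i) :
    tr a X i m n h x = (Ext.mk₀ (pr (Ideal.pow_le_pow_right h))).comp x (zero_add i) := rfl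

instance (a : Ideal R) (X : ModuleCat.{0} R) (i : ℕ) :
    DirectedSystem (fun n => Ext (Q a n) X i) (fun m n h => tr a X i m n h) where
  map_self n x := by
    simp [tr_apply, pr_refl]
  map_map i j k hij hjk x := by
    simp [tr_apply, pr_comp]

/-- Model of local cohomology. -/
noncomputable def L (a : Ideal R) (i : ℕ) (X : ModuleCat.{0} R) : ModuleCat.{0} R :=
  ModuleCat.of R (Module.DirectLimit (fun n => Ext (Q a n) X i) (tr a X i))

/-- canonical map -/
noncomputable def of (a : Ideal R) (X : ModuleCat.{0} R) (i : ℕ) (n : ℕ) :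
    Ext (Q a n) X i →ₗ[R] L a i X :=
  Module.DirectLimit.of R ℕ (fun n => Ext (Q a n) X i) (tr a X i) n

lemma exists_of {a : Ideal R} {X : ModuleCat.{0} R} {i : ℕ} (z : L a i X) :
    ∃ n x, of a X i n x = z := Module.DirectLimit.exists_of z

lemma of_zero {a : Ideal R} {X : ModuleCat.{0} R} {i n : ℕ} {x : Ext (Q a n) X i}
    (h : of a X i n x = 0) : ∃ m, ∃ h : n ≤ m, tr a X i n m h x = 0 :=
  Module.DirectLimit.of.zero_exact h

lemma of_tr {a : Ideal R} {X : ModuleCat.{0} R} {i m n : ℕ} (h : m ≤ n) (x : Ext (Q a m) X i) :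
    of a X i n (tr a X i m n h x) = of a X i m x :=
  Module.DirectLimit.of_f

/-- general operation : postcomposition with an Ext class -/
noncomputable def post (a : Ideal R) {X Y : ModuleCat.{0} R} {k : ℕ} (β : Ext X Y k) (i j : ℕ)
    (h : i + k = j) : L a i X →ₗ[R] L a j Y :=
  Module.DirectLimit.map (fun n => β.postcompOfLinear R (Q a n) h) (by
    intro m n hmn
    ext x
    simp only [LinearMap.comp_apply, tr_apply]
    simp only [Ext.postcompOfLinear, LinearMap.flip_apply, Ext.bilinearCompOfLinear_apply_apply]
    rw [Ext.comp_assoc]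
    omega)

lemma post_of (a : Ideal R) {X Y : ModuleCat.{0} R} {k : ℕ} (β : Ext X Y k) (i j : ℕ)
    (h : i + k = j) (n : ℕ) (x : Ext (Q a n) X i) :
    post a β i j h (of a X i n x) = of a Y j n (x.comp β h) :=
  Module.DirectLimit.map_apply_of _ _ _

/-- functoriality -/
noncomputable def map (a : Ideal R) (i : ℕ) {X Y : ModuleCat.{0} R} (f : X ⟶ Y) :
    L a i X →ₗ[R] L a i Y := post a (Ext.mk₀ f) i i (add_zero i)

/-- connecting map -/
noncomputable def δ (a : Ideal R) (i : ℕ) {S : ShortComplex (ModuleCat.{0} R)}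
    (hS : S.ShortExact) : L a i S.X₃ →ₗ[R] L a (i + 1) S.X₁ := post a hS.extClass i (i + 1) rfl

lemma map_comp (a : Ideal R) (i : ℕ) {X Y Z : ModuleCat.{0} R} (f : X ⟶ Y) (g : Y ⟶ Z)
    (x : L a i X) : map a i (f ≫ g) x = map a i g (map a i f x) := by
  obtain ⟨n, x, rfl⟩ := exists_of x
  simp [map, post_of]

lemma map_id (a : Ideal R) (i : ℕ) {X : ModuleCat.{0} R} 
    (x : L a i X) : map a i (𝟙 X) x = x := by
  obtain ⟨n, x, rfl⟩ := exists_of x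
  simp [map, post_of]

lemma map_smul_id (a : Ideal R) (i : ℕ) {X : ModuleCat.{0} R} (r : R)
    (x : L a i X) : map a i (r • 𝟙 X) x = r • x := by
  obtain ⟨n, x, rfl⟩ := exists_of x
  rw [map, post_of, ← Ext.smul_eq_comp_mk₀, map_smul]

/-- isos -/
noncomputable def mapEquiv (a : Ideal R) (i : ℕ) {X Y : ModuleCat.{0} R} (e : X ≅ Y) :
    L a i X ≃ₗ[R] L a i Y :=
  LinearEquiv.ofLinearMap (map a i e.hom) (map a i e.inv)
    (by
      refine LinearMap.ext fun x => ?_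
      rw [LinearMap.comp_apply, ← map_comp, e.inv_hom_id, map_id]; rfl)
    (by
      refine LinearMap.ext fun x => ?_
      rw [LinearMap.comp_apply, ← map_comp, e.hom_inv_id, map_id]; rfl)

section exact
variable (a : Ideal R) (i : ℕ) {S : ShortComplex (ModuleCat.{0} R)} (hS : S.ShortExact)

lemma exact₂ (hS : S.ShortExact) : Function.Exact (map a i S.f) (map a i S.g) := by
  intro z
  constructor
  · intro h
    obtain ⟨n, x, rfl⟩ := exists_of z
    rw [map, post_of] at h
    obtain ⟨m, hm, h⟩ := of_zero h
    rw [tr_apply, ← Ext.comp_assoc _ _ _ (zero_add _) _ (by omega), ← tr_apply (h := hm)] at h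
    obtain ⟨y, hy⟩ := Ext.covariant_sequence_exact₂ _ hS _ h
    refine ⟨of _ _ _ _ y, ?_⟩
    rw [map, post_of, hy, of_tr]
  · rintro ⟨y, rfl⟩
    obtain ⟨n, y, rfl⟩ := exists_of y
    simp [map, post_of]

lemma exact₃ : Function.Exact (map a i S.g) (δ a i hS) := by
  intro z
  constructor
  · intro h
    obtain ⟨n, x, rfl⟩ := exists_of z
    rw [δ, post_of] at h
    obtain ⟨m, hm, h⟩ := of_zero h
    rw [tr_apply, ← Ext.comp_assoc _ _ _ (zero_add _) _ (by omega), ← tr_apply (h := hm)] at h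
    obtain ⟨y, hy⟩ := Ext.covariant_sequence_exact₃ _ hS _ _ h
    refine ⟨of _ _ _ _ y, ?_⟩
    rw [map, post_of, hy, of_tr]
  · rintro ⟨y, rfl⟩
    obtain ⟨n, y, rfl⟩ := exists_of y
    simp [map, δ, post_of]

lemma exact₁ : Function.Exact (δ a i hS) (map a (i+1) S.f) := by
  intro z
  constructor
  · intro h
    obtain ⟨n, x, rfl⟩ := exists_of z
    rw [map, post_of] at h
    obtain ⟨m, hm, h⟩ := of_zero h
    rw [tr_apply, ← Ext.comp_assoc _ _ _ (zero_add _) _ (by omega), ← tr_apply (h := hm)] at h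
    obtain ⟨y, hy⟩ := Ext.covariant_sequence_exact₁ _ hS _ h rfl
    refine ⟨of _ _ _ _ y, ?_⟩
    rw [δ, post_of, hy, of_tr]
  · rintro ⟨y, rfl⟩
    obtain ⟨n, y, rfl⟩ := exists_of y
    simp [map, δ, post_of]

end exact

lemma subsingleton_of_injective (a : Ideal R) (i : ℕ) (X : ModuleCat.{0} R) [Injective X] :
    Subsingleton (L a (i + 1) X) := by
  refine subsingleton_of_forall_eq 0 fun z => ?_
  obtain ⟨n, x, rfl⟩ := exists_of z
  rw [Ext.eq_zero_of_injective x, map_zero]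

/-- annihilation -/
lemma smul_eq_zero (a : Ideal R) (i : ℕ) (X : ModuleCat.{0} R) (r : R) (h : ∀ x : X, r • x = 0)
    (z : L a i X) : r • z = 0 := by
  obtain ⟨n, x, rfl⟩ := exists_of z
  have : r • 𝟙 X = 0 := by
    ext x
    exact h x
  rw [← map_smul_id, this]
  simp [map, post_of]

lemma subsingleton_of_bijective (x : R) (i : ℕ) (X : ModuleCat.{0} R)
    (h : Function.Bijective (fun y : X => x • y)) : Subsingleton (L (Ideal.span {x}) i X) := by
  refine subsingleton_of_forall_eq 0 fun z => ?_
  obtain ⟨n, z, rfl⟩ := exists_of z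
  have h1 : x ^ n • of (Ideal.span {x}) X i n z = 0 := by
    have : (x ^ n) • 𝟙 (Q (Ideal.span {x}) n) = 0 := by
      ext
      change x ^ n • (Submodule.Quotient.mk 1 : R ⧸ (Ideal.span {x} ^ n)) = 0
      rw [← Submodule.Quotient.mk_smul, Submodule.Quotient.mk_eq_zero]
      rw [Ideal.span_singleton_pow]
      exact Ideal.mem_span_singleton.2 (by simp)
    rw [← map_smul]
    have h2 := Ext.mk₀_id_comp z
    rw [← h2, ← Ext.smul_comp, ← Ext.mk₀_smul, this]
    simp
  have key : ∀ w : L (Ideal.span {x}) i X, x • w = 0 → w = 0 := by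
    intro w hw
    let e : X ≃ₗ[R] X := LinearEquiv.ofBijective (x • LinearMap.id) h
    have : map (Ideal.span {x}) i (e.toModuleIso.hom) w = 0 := by
      rw [← hw, ← map_smul_id]
      rfl
    rw [← map_id _ _ w, ← e.toModuleIso.hom_inv_id, map_comp, this, map_zero]
  generalize of (Ideal.span {x}) X i n z = w at h1
  clear z
  induction n with
  | zero => simpa using h1
  | succ n ih =>
    refine ih (key _ ?_)
    rw [← mul_smul, ← pow_succ', h1]

/-- Comparison between two ideals -/
noncomputable def θ {a c : Ideal R} (h : a ≤ c) (i : ℕ) (X : ModuleCat.{0} R) :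
    L c i X →ₗ[R] L a i X :=
  Module.DirectLimit.map (fun n => 
    (Ext.mk₀ (pr (Ideal.pow_right_mono h n))).precompOfLinear R X (zero_add i)) (by
    intro m n hmn
    ext x
    simp [tr_apply, pr_comp])

lemma θ_of {a c : Ideal R} (h : a ≤ c) (i : ℕ) (X : ModuleCat.{0} R) (n : ℕ)
    (x : Ext (Q c n) X i) :
    θ h i X (of c X i n x) = 
      of a X i n ((Ext.mk₀ (pr (Ideal.pow_right_mono h n))).comp x (zero_add i)) :=
  Module.DirectLimit.map_apply_of _ _ _

lemma θ_post {a c : Ideal R} (h : a ≤ c) {X Y : ModuleCat.{0} R} {k : ℕ} (β : Ext X Y k) (i j : ℕ)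
    (hij : i + k = j) (x : L c i X) :
    θ h j Y (post c β i j hij x) = post a β i j hij (θ h i X x) := by
  obtain ⟨n, x, rfl⟩ := exists_of x
  rw [post_of, θ_of, θ_of, post_of, Ext.comp_assoc (h := by omega)]

/-- evaluation -/
noncomputable def ev (a : Ideal R) (X : ModuleCat.{0} R) : L a 0 X →ₗ[R] X :=
  Module.DirectLimit.lift R ℕ (fun n => Ext (Q a n) X 0) (tr a X 0)
    (fun n => (LinearMap.applyₗ (R := R) (M := R ⧸ a ^ n) (M₂ := X) (Submodule.Quotient.mk 1)) ∘ₗ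
      (ModuleCat.homLinearEquiv (S := R) (M := Q a n) (N := X)).toLinearMap ∘ₗ
      (Ext.linearEquiv₀ (R := R) (X := Q a n) (Y := X)).toLinearMap) (by
    intro m n h x
    obtain ⟨f, rfl⟩ := (Ext.linearEquiv₀ (R := R) (X := Q a m) (Y := X)).symm.surjective x
    have : tr a X 0 m n h ((Ext.linearEquiv₀ (R := R)).symm f) = 
        (Ext.linearEquiv₀ (R := R)).symm (pr (Ideal.pow_le_pow_right h) ≫ f) := by
      simp [tr_apply]
    rw [this]
    simp only [LinearMap.comp_apply, LinearEquiv.coe_coe, LinearEquiv.apply_symm_apply]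
    rfl)

lemma ev_of (a : Ideal R) (X : ModuleCat.{0} R) (n : ℕ) (f : Q a n ⟶ X) :
    ev a X (of a X 0 n (Ext.mk₀ f)) = f.hom (Submodule.Quotient.mk 1) := by
  refine (Module.DirectLimit.lift_of _ _ _).trans ?_
  rw [← Ext.linearEquiv₀_symm_apply (R := R)]
  simp only [LinearMap.comp_apply, LinearEquiv.coe_coe, LinearEquiv.apply_symm_apply]
  rfl

lemma exists_of₀ {a : Ideal R} {X : ModuleCat.{0} R} (z : L a 0 X) :
    ∃ n f, of a X 0 n (Ext.mk₀ f) = z := by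
  obtain ⟨n, x, rfl⟩ := exists_of z
  obtain ⟨f, rfl⟩ := (Ext.mk₀_bijective _ _).2 x
  exact ⟨n, f, rfl⟩

lemma ev_injective (a : Ideal R) (X : ModuleCat.{0} R) : Function.Injective (ev a X) := by
  rw [injective_iff_map_eq_zero]
  intro z hz
  obtain ⟨n, f, rfl⟩ := exists_of₀ z
  rw [ev_of] at hz
  have : f = 0 := by
    ext
    simpa using hz
  simp [this]

/-- torsion submodule -/
def Γ (a : Ideal R) (X : Type) [AddCommGroup X] [Module R X] : Submodule R X where
  carrier := {x | ∃ n : ℕ, ∀ r ∈ a ^ n, r • x = 0}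
  zero_mem' := ⟨0, by simp⟩
  add_mem' := by
    rintro x y ⟨n, hn⟩ ⟨m, hm⟩
    refine ⟨n + m, fun r hr => ?_⟩
    rw [smul_add, hn r (Ideal.pow_le_pow_right (by omega) hr),
      hm r (Ideal.pow_le_pow_right (by omega) hr), add_zero]
  smul_mem' := by
    rintro c x ⟨n, hn⟩
    exact ⟨n, fun r hr => by rw [smul_comm, hn r hr, smul_zero]⟩

lemma mem_Γ {a : Ideal R} {X : Type} [AddCommGroup X] [Module R X] {x : X} :
    x ∈ Γ a X ↔ ∃ n : ℕ, ∀ r ∈ a ^ n, r • x = 0 := Iff.rfl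

lemma range_ev (a : Ideal R) (X : ModuleCat.{0} R) : LinearMap.range (ev a X) = Γ a X := by
  ext x
  constructor
  · rintro ⟨z, rfl⟩
    obtain ⟨n, f, rfl⟩ := exists_of₀ z
    rw [ev_of]
    refine ⟨n, fun r hr => ?_⟩
    rw [← map_smul, ← Submodule.Quotient.mk_smul, (Submodule.Quotient.mk_eq_zero _).2, map_zero]
    simpa using hr
  · rintro ⟨n, hn⟩
    refine ⟨of a X 0 n (Ext.mk₀ (ModuleCat.ofHom 
      (Submodule.liftQ _ (LinearMap.toSpanSingleton R X x) ?_))), ?_⟩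
    · intro r hr
      exact hn r hr
    · rw [ev_of]
      exact one_smul _ _

lemma ev_map (a : Ideal R) {X Y : ModuleCat.{0} R} (f : X ⟶ Y) (x : L a 0 X) :
    ev a Y (map a 0 f x) = f.hom (ev a X x) := by
  obtain ⟨n, g, rfl⟩ := exists_of₀ x
  rw [map, post_of, Ext.mk₀_comp_mk₀, ev_of, ev_of]
  rfl

lemma ev_θ {a c : Ideal R} (h : a ≤ c) (X : ModuleCat.{0} R) (x : L c 0 X) :
    ev a X (θ h 0 X x) = ev c X x := by
  obtain ⟨n, g, rfl⟩ := exists_of₀ x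
  rw [θ_of, Ext.mk₀_comp_mk₀, ev_of, ev_of]
  rfl

end LC

namespace LC
open CategoryTheory.Abelian

variable {R : Type} [CommRing R]

section gamma
variable {X : Type} [AddCommGroup X] [Module R X]

lemma exists_uniform (a : Ideal R) (N : Submodule R X) (hN : N.FG) (h : N ≤ Γ a X) :
    ∃ n : ℕ, ∀ x ∈ N, ∀ r ∈ a ^ n, r • x = 0 := by
  induction N, hN using Submodule.fg_induction with
  | singleton x =>
    obtain ⟨n, hn⟩ := h (Submodule.mem_span_singleton_self x)
    refine ⟨n, fun y hy r hr => ?_⟩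
    obtain ⟨s, rfl⟩ := Submodule.mem_span_singleton.1 hy
    rw [smul_comm, hn r hr, smul_zero]
  | sup N₁ N₂ _ _ h1 h2 =>
    obtain ⟨n, hn⟩ := h1 (le_sup_left.trans h)
    obtain ⟨m, hm⟩ := h2 (le_sup_right.trans h)
    refine ⟨n + m, fun y hy r hr => ?_⟩
    obtain ⟨y, hy', z, hz, rfl⟩ := Submodule.mem_sup.1 hy
    rw [smul_add, hn y hy' r (Ideal.pow_le_pow_right (by omega) hr),
      hm z hz r (Ideal.pow_le_pow_right (by omega) hr), add_zero]

lemma Γ_anti {a c : Ideal R} (h : a ≤ c) : Γ c X ≤ Γ a X := by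
  rintro x ⟨n, hn⟩
  exact ⟨n, fun r hr => hn r (Ideal.pow_right_mono h n hr)⟩

lemma mem_Γ_add {a b : Ideal R} {x : X} (ha : x ∈ Γ a X) (hb : x ∈ Γ b X) : x ∈ Γ (a + b) X := by
  obtain ⟨n, hn⟩ := ha
  obtain ⟨m, hm⟩ := hb
  refine ⟨n + m, fun r hr => ?_⟩
  obtain ⟨s, hs, t, ht, rfl⟩ := Submodule.mem_sup.1 (Ideal.sup_pow_add_le_pow_sup_pow hr)
  rw [add_smul, hn s hs, hm t ht, add_zero]

variable [IsNoetherianRing R]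

lemma Γ_quot (a : Ideal R) : Γ a (X ⧸ Γ a X) = ⊥ := by
  rw [eq_bot_iff]
  rintro x ⟨n, hn⟩
  obtain ⟨x, rfl⟩ := Submodule.Quotient.mk_surjective _ x
  have : ∀ r ∈ a ^ n, r • x ∈ Γ a X := by
    intro r hr
    have := hn r hr
    rwa [← Submodule.Quotient.mk_smul, Submodule.Quotient.mk_eq_zero] at this
  obtain ⟨m, hm⟩ := exists_uniform a (Submodule.map (LinearMap.toSpanSingleton R X x) (a ^ n))
    (Submodule.FG.map _ (IsNoetherian.noetherian _)) (by
      rintro _ ⟨r, hr, rfl⟩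
      exact this r hr)
  rw [Submodule.mem_bot, Submodule.Quotient.mk_eq_zero]
  refine ⟨m + n, fun r hr => ?_⟩
  rw [pow_add] at hr
  induction hr using Submodule.mul_induction_on' with
  | mem_mul_mem s hs t ht =>
    rw [mul_smul]
    exact hm _ ⟨t, ht, rfl⟩ s hs
  | add s _ t _ h1 h2 => rw [add_smul, h1, h2, add_zero]

lemma baer_Γ (a : Ideal R) [hX : Module.Injective R X] : Module.Injective R (Γ a X) := by
  rw [← Module.Baer.iff_injective]
  intro J f
  obtain ⟨n, hn⟩ := exists_uniform a (LinearMap.range ((Γ a X).subtype ∘ₗ f))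
    (by
      rw [LinearMap.range_eq_map]
      exact Submodule.FG.map _ (IsNoetherian.noetherian _)) (by
      rintro _ ⟨r, rfl⟩
      exact (f r).2)
  obtain ⟨k, hk⟩ := Ideal.exists_pow_inf_eq_pow_smul a (M := R) J
  have hk := hk (n + k) (by omega)
  -- the kernel
  have hker : ∀ j : J, (j : R) ∈ a ^ (n + k) → f j = 0 := by
    intro j hj
    have h1 : (j : R) ∈ a ^ n • J := by
      have : (j : R) ∈ a ^ (n + k) • (⊤ : Submodule R R) ⊓ J := ⟨by simpa using hj, j.2⟩
      rw [hk, Nat.add_sub_cancel] at this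
      exact Submodule.smul_mono le_rfl inf_le_right this
    have h2 : ∀ x ∈ a ^ n • J, ∀ hx : x ∈ J, f ⟨x, hx⟩ = 0 := by
      intro x hx
      induction hx using Submodule.smul_induction_on' with
      | smul r hr m hm =>
        intro hx
        have : (⟨r • m, hx⟩ : J) = r • ⟨m, hm⟩ := rfl
        rw [this, map_smul]
        apply Subtype.ext
        exact hn _ ⟨⟨m, hm⟩, rfl⟩ r hr
      | add x hx y hy h1 h2 =>
        intro h
        have hx' : x ∈ J := Submodule.smul_le_right hx
        have hy' : y ∈ J := Submodule.smul_le_right hy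
        have : (⟨x + y, h⟩ : J) = ⟨x, hx'⟩ + ⟨y, hy'⟩ := rfl
        rw [this, map_add, h1, h2, add_zero]
    exact h2 _ h1 j.2
  let π : J →ₗ[R] R ⧸ a ^ (n + k) := (a ^ (n + k)).mkQ ∘ₗ J.subtype
  have hπ : LinearMap.ker π ≤ LinearMap.ker ((Γ a X).subtype ∘ₗ f) := by
    intro j hj
    have : (j : R) ∈ a ^ (n + k) := by
      rw [LinearMap.mem_ker] at hj
      exact (Submodule.Quotient.mk_eq_zero _).1 hj
    simp [hker j this]
  obtain ⟨h, hh⟩ := hX.out ((LinearMap.ker π).liftQ π le_rfl)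
    (LinearMap.ker_eq_bot.1 (Submodule.ker_liftQ_eq_bot _ _ _ le_rfl))
    ((LinearMap.ker π).liftQ ((Γ a X).subtype ∘ₗ f) hπ)
  have hmem : ∀ y, h y ∈ Γ a X := by
    intro y
    refine ⟨n + k, fun r hr => ?_⟩
    rw [← map_smul]
    obtain ⟨y, rfl⟩ := Submodule.Quotient.mk_surjective _ y
    rw [← Submodule.Quotient.mk_smul, (Submodule.Quotient.mk_eq_zero _).2, map_zero]
    exact Ideal.mul_mem_right _ _ hr
  refine ⟨LinearMap.codRestrict _ (h ∘ₗ (a ^ (n + k)).mkQ) (fun y => hmem _), fun x hx => ?_⟩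
  apply Subtype.ext
  exact hh (Submodule.Quotient.mk ⟨x, hx⟩)

/-- the quotient of an injective by its torsion is injective -/
lemma inj_quot (a : Ideal R) [hX : Module.Injective R X] : Module.Injective R (X ⧸ Γ a X) := by
  obtain ⟨p, hp⟩ := (baer_Γ (X := X) a).out (Γ a X).subtype (Submodule.injective_subtype _)
    LinearMap.id
  refine ⟨fun A B _ _ _ _ f hf g => ?_⟩
  -- section
  let s : (X ⧸ Γ a X) →ₗ[R] X := (Γ a X).liftQ (LinearMap.id - (Γ a X).subtype ∘ₗ p) (by
    intro x hx
    have := hp ⟨x, hx⟩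
    simp only [Submodule.subtype_apply] at this
    simp [this])
  have hs : ∀ y, (Γ a X).mkQ (s y) = y := by
    intro y
    obtain ⟨y, rfl⟩ := Submodule.Quotient.mk_surjective _ y
    change (Γ a X).mkQ (y - (p y : X)) = _
    rw [map_sub]
    simp
  obtain ⟨h, hh⟩ := hX.out f hf (s ∘ₗ g)
  refine ⟨(Γ a X).mkQ ∘ₗ h, fun x => ?_⟩
  rw [LinearMap.comp_apply, hh, LinearMap.comp_apply, hs]

end gamma

section ses

/-- short complex from linear maps -/
abbrev sc {X Y Z : Type} [AddCommGroup X] [Module R X] [AddCommGroup Y] [Module R Y]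
    [AddCommGroup Z] [Module R Z] (f : X →ₗ[R] Y) (g : Y →ₗ[R] Z) (h : Function.Exact f g) :
    ShortComplex (ModuleCat.{0} R) :=
  ShortComplex.mk (ModuleCat.ofHom f) (ModuleCat.ofHom g) (by
    ext x
    exact h.apply_apply_eq_zero x)

lemma sc_exact {X Y Z : Type} [AddCommGroup X] [Module R X] [AddCommGroup Y] [Module R Y]
    [AddCommGroup Z] [Module R Z] (f : X →ₗ[R] Y) (g : Y →ₗ[R] Z) (h : Function.Exact f g)
    (hf : Function.Injective f) (hg : Function.Surjective g) : (sc f g h).ShortExact := by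
  have : Mono (sc f g h).f := (ModuleCat.mono_iff_injective _).2 hf
  have : Epi (sc f g h).g := (ModuleCat.epi_iff_surjective _).2 hg
  exact ⟨(ShortComplex.ShortExact.moduleCat_exact_iff_function_exact _).2 h⟩

variable [IsNoetherianRing R]

lemma exists_emb (X : ModuleCat.{0} R) : ∃ (I : Type) (_ : AddCommGroup I) (_ : Module R I)
    (f : X →ₗ[R] I), Module.Injective R I ∧ Function.Injective f := by
  refine ⟨((Injective.under X : ModuleCat.{0} R) : Type), inferInstance, inferInstance, (Injective.ι X).hom, ?_, ?_⟩
  · rw [Module.injective_iff_injective_object]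
    exact (inferInstance : Injective (Injective.under X))
  · exact (ModuleCat.mono_iff_injective _).1 inferInstance

lemma ses_tors (a : Ideal R) (X : ModuleCat.{0} R) : ∃ S : ShortComplex (ModuleCat.{0} R),
    S.ShortExact ∧ S.X₁ = ModuleCat.of R (Γ a X) ∧ S.X₂ = X ∧ Γ a S.X₃ = ⊥ := by
  refine ⟨_, sc_exact (Γ a X).subtype (Γ a X).mkQ (LinearMap.exact_subtype_mkQ _)
    (Submodule.injective_subtype _) (Submodule.mkQ_surjective _), rfl, rfl, ?_⟩
  exact Γ_quot a

/-- torsion modules embed in torsion injectives -/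
lemma ses_of_tors (a : Ideal R) (X : ModuleCat.{0} R) (h : Γ a X = ⊤) :
    ∃ S : ShortComplex (ModuleCat.{0} R),
    S.ShortExact ∧ S.X₁ = X ∧ Injective S.X₂ ∧ Γ a S.X₂ = ⊤ ∧ Γ a S.X₃ = ⊤ := by
  obtain ⟨I, _, _, f, hI, hf⟩ := exists_emb X
  have hmem : ∀ x, f x ∈ Γ a I := by
    intro x
    obtain ⟨n, hn⟩ : x ∈ Γ a X := h ▸ Submodule.mem_top
    exact ⟨n, fun r hr => by rw [← map_smul, hn r hr, map_zero]⟩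
  let g : X →ₗ[R] Γ a I := f.codRestrict _ hmem
  have hg : Function.Injective g := fun x y hxy => hf (congrArg Subtype.val hxy)
  have ht : Γ a (Γ a I) = ⊤ := by
    rw [eq_top_iff]
    rintro ⟨x, n, hn⟩ -
    exact ⟨n, fun r hr => Subtype.ext (hn r hr)⟩
  refine ⟨_, sc_exact g (LinearMap.range g).mkQ (LinearMap.exact_map_mkQ_range g) hg
    (Submodule.mkQ_surjective _), rfl, ?_, ht, ?_⟩
  · exact (Module.injective_iff_injective_object R _).1 (baer_Γ a)
  · rw [eq_top_iff]
    intro x _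
    obtain ⟨x, rfl⟩ := Submodule.mkQ_surjective _ x
    obtain ⟨n, hn⟩ : x ∈ Γ a (Γ a I) := ht ▸ Submodule.mem_top
    exact ⟨n, fun r hr => by
      change r • (LinearMap.range g).mkQ x = 0
      rw [← map_smul, hn r hr, map_zero]⟩

/-- torsion-free modules embed in torsion-free injectives -/
lemma ses_of_free (a : Ideal R) (X : ModuleCat.{0} R) (h : Γ a X = ⊥) :
    ∃ S : ShortComplex (ModuleCat.{0} R),
    S.ShortExact ∧ S.X₁ = X ∧ Injective S.X₂ ∧ Γ a S.X₂ = ⊥ := by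
  obtain ⟨I, _, _, f, hI, hf⟩ := exists_emb X
  let g : X →ₗ[R] I ⧸ Γ a I := (Γ a I).mkQ ∘ₗ f
  have hg : Function.Injective g := by
    rw [injective_iff_map_eq_zero]
    intro x hx
    have hx : f x ∈ Γ a I := (Submodule.Quotient.mk_eq_zero _).1 hx
    obtain ⟨n, hn⟩ := hx
    have : x ∈ Γ a X := ⟨n, fun r hr => hf (by rw [map_smul, hn r hr, map_zero])⟩
    rw [h] at this
    simpa using this
  refine ⟨_, sc_exact g (LinearMap.range g).mkQ (LinearMap.exact_map_mkQ_range g) hg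
    (Submodule.mkQ_surjective _), rfl, ?_, Γ_quot a⟩
  exact (Module.injective_iff_injective_object R _).1 (inj_quot a)

end ses

section shift
variable (a : Ideal R) (i : ℕ) {S : ShortComplex (ModuleCat.{0} R)} (hS : S.ShortExact)

lemma sub₂ (hS : S.ShortExact) (h1 : Subsingleton (L a i S.X₁)) (h3 : Subsingleton (L a i S.X₃)) :
    Subsingleton (L a i S.X₂) := by
  refine subsingleton_of_forall_eq 0 fun z => ?_
  obtain ⟨y, rfl⟩ := (exact₂ a i hS z).1 (Subsingleton.elim _ _)
  rw [Subsingleton.elim y 0, map_zero]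

lemma sub₃ (hS : S.ShortExact) (h2 : Subsingleton (L a i S.X₂)) (h1 : Subsingleton (L a (i + 1) S.X₁)) :
    Subsingleton (L a i S.X₃) := by
  refine subsingleton_of_forall_eq 0 fun z => ?_
  obtain ⟨y, rfl⟩ := (exact₃ a i hS z).1 (Subsingleton.elim _ _)
  rw [Subsingleton.elim y 0, map_zero]

lemma sub₁ (hS : S.ShortExact) (h3 : Subsingleton (L a i S.X₃)) (h2 : Subsingleton (L a (i + 1) S.X₂)) :
    Subsingleton (L a (i + 1) S.X₁) := by
  refine subsingleton_of_forall_eq 0 fun z => ?_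
  obtain ⟨y, rfl⟩ := (exact₁ a i hS z).1 (Subsingleton.elim _ _)
  rw [Subsingleton.elim y 0, map_zero]

/-- shift -/
noncomputable def shiftEquiv (h : Subsingleton (L a i S.X₂))
    (h' : Subsingleton (L a (i + 1) S.X₂)) : L a i S.X₃ ≃ₗ[R] L a (i + 1) S.X₁ :=
  LinearEquiv.ofBijective (δ a i hS) ⟨by
    rw [injective_iff_map_eq_zero]
    intro z hz
    obtain ⟨y, rfl⟩ := (exact₃ a i hS z).1 hz
    rw [Subsingleton.elim y 0, map_zero], fun z =>
    (exact₁ a i hS z).1 (Subsingleton.elim _ _)⟩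

/-- quotient by acyclic -/
noncomputable def gEquiv (h : Subsingleton (L a i S.X₁))
    (h' : Subsingleton (L a (i + 1) S.X₁)) : L a i S.X₂ ≃ₗ[R] L a i S.X₃ :=
  have := hS
  LinearEquiv.ofBijective (map a i S.g) ⟨by
    rw [injective_iff_map_eq_zero]
    intro z hz
    obtain ⟨y, rfl⟩ := (exact₂ a i hS z).1 hz
    rw [Subsingleton.elim y 0, map_zero], fun z =>
    (exact₃ a i hS z).1 (Subsingleton.elim _ _)⟩

lemma map_f_injective (hS : S.ShortExact) (h : i = 0 ∨ ∃ j, i = j + 1 ∧ Subsingleton (L a j S.X₃)) :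
    Function.Injective (map a i S.f) := by
  rw [injective_iff_map_eq_zero]
  intro z hz
  rcases h with rfl | ⟨j, rfl, hj⟩
  · apply ev_injective
    have := hS.mono_f
    apply (ModuleCat.mono_iff_injective S.f).1 inferInstance
    have := ev_map a S.f z
    rw [hz, map_zero] at this
    rw [map_zero, map_zero]
    exact this.symm
  · obtain ⟨y, rfl⟩ := (exact₁ a j hS z).1 hz
    rw [Subsingleton.elim y 0, map_zero]

/-- sub with acyclic quotient -/
noncomputable def fEquiv (h : ∀ i, Subsingleton (L a i S.X₃)) : L a i S.X₁ ≃ₗ[R] L a i S.X₂ :=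
  have := hS
  LinearEquiv.ofBijective (map a i S.f) ⟨by
    refine map_f_injective a i hS ?_
    rcases i with _ | j
    · exact Or.inl rfl
    · exact Or.inr ⟨j, rfl, h j⟩, fun z =>
    (exact₂ a i hS z).1 (@Subsingleton.elim _ (h i) _ _)⟩

/-- degree zero -/
noncomputable def zeroEquiv (X : ModuleCat.{0} R) : L a 0 X ≃ₗ[R] Γ a X :=
  (LinearEquiv.ofInjective _ (ev_injective a X)).trans (LinearEquiv.ofEq _ _ (range_ev a X))

lemma zero_sub {X : ModuleCat.{0} R} (h : Γ a X = ⊥) : Subsingleton (L a 0 X) := by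
  have : Subsingleton (Γ a X) := by rw [h]; infer_instance
  exact (zeroEquiv a X).toEquiv.subsingleton

lemma bot_of_sub {X : ModuleCat.{0} R} (h : Subsingleton (L a 0 X)) : Γ a X = ⊥ := by
  have : Subsingleton (Γ a X) := (zeroEquiv a X).symm.toEquiv.subsingleton
  exact Submodule.subsingleton_iff_eq_bot.1 this

end shift

section main
variable [IsNoetherianRing R]

lemma tors_acyclic (b : Ideal R) (i : ℕ) : ∀ (N : ModuleCat.{0} R), Γ b N = ⊤ → 
    Subsingleton (L b (i + 1) N) := by
  induction i with
  | zero =>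
    intro N hN
    obtain ⟨S, hS, rfl, hI, h2, h3⟩ := ses_of_tors b N hN
    refine subsingleton_of_forall_eq 0 fun z => ?_
    have := subsingleton_of_injective b 0 S.X₂
    obtain ⟨y, rfl⟩ := (exact₁ b 0 hS z).1 (Subsingleton.elim _ _)
    refine (exact₃ b 0 hS y).2 ?_
    have := hS.epi_g
    obtain ⟨w, hw⟩ := (ModuleCat.epi_iff_surjective S.g).1 inferInstance (ev b _ y)
    have hw' : w ∈ LinearMap.range (ev b S.X₂) := by
      rw [range_ev, h2]; trivial
    obtain ⟨v, rfl⟩ := hw'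
    refine ⟨v, ev_injective _ _ ?_⟩
    rw [ev_map]
    exact hw
  | succ i ih =>
    intro N hN
    obtain ⟨S, hS, rfl, hI, h2, h3⟩ := ses_of_tors b N hN
    exact sub₁ b _ hS (ih _ h3) (subsingleton_of_injective b _ S.X₂)

lemma θ_bij (a b : Ideal R) (h : a ≤ a + b) (i : ℕ) : ∀ (N : ModuleCat.{0} R), Γ b N = ⊤ → 
    Function.Bijective (θ h i N) := by
  induction i with
  | zero =>
    intro N hN
    constructor
    · intro x y hxy
      apply ev_injective
      rw [← ev_θ h, hxy, ev_θ]
    · intro y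
      have h1 : ev a N y ∈ Γ a N := by
        rw [← range_ev]; exact ⟨y, rfl⟩
      have h2 : ev a N y ∈ Γ (a + b) N := mem_Γ_add h1 (hN ▸ Submodule.mem_top)
      rw [← range_ev] at h2
      obtain ⟨x, hx⟩ := h2
      refine ⟨x, ev_injective _ _ ?_⟩
      rw [ev_θ, hx]
  | succ i ih =>
    intro N hN
    obtain ⟨S, hS, rfl, hI, h2, h3⟩ := ses_of_tors b N hN
    have s1 := subsingleton_of_injective a i S.X₂
    have s2 := subsingleton_of_injective (a + b) i S.X₂
    constructor
    · rw [injective_iff_map_eq_zero]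
      intro z hz
      obtain ⟨z, rfl⟩ := (exact₁ (a + b) i hS z).1 (Subsingleton.elim _ _)
      rw [δ, θ_post] at hz
      obtain ⟨w, hw⟩ := (exact₃ a i hS _).1 hz
      obtain ⟨w, rfl⟩ := (ih _ h2).2 w
      rw [map, ← θ_post] at hw
      have := (ih _ h3).1 hw
      exact (exact₃ (a + b) i hS z).2 ⟨w, this⟩
    · intro z
      obtain ⟨z, rfl⟩ := (exact₁ a i hS z).1 (Subsingleton.elim _ _)
      obtain ⟨w, rfl⟩ := (ih _ h3).2 z
      exact ⟨δ _ _ hS w, θ_post _ _ _ _ _ _⟩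

/-- b-torsion modules -/
noncomputable def torsEquiv (a b : Ideal R) (i : ℕ) (N : ModuleCat.{0} R) (h : Γ b N = ⊤) :
    L (a + b) i N ≃ₗ[R] L a i N :=
  LinearEquiv.ofBijective _ (θ_bij a b le_sup_left i N h)

lemma Γ_Γ (b : Ideal R) (M : ModuleCat.{0} R) : Γ b (ModuleCat.of R (Γ b M)) = ⊤ := by
  rw [eq_top_iff]
  rintro ⟨x, n, hn⟩ -
  exact ⟨n, fun r hr => Subtype.ext (hn r hr)⟩

lemma free_all (a b : Ideal R) (n : ℕ) : ∀ M : ModuleCat.{0} R, 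
    (∀ q, Subsingleton (L b q M)) → Subsingleton (L (a + b) n M) := by
  induction n with
  | zero =>
    intro M h
    apply zero_sub
    rw [eq_bot_iff, ← bot_of_sub b (h 0)]
    exact Γ_anti le_sup_right
  | succ n ih =>
    intro M h
    obtain ⟨S, hS, rfl, hI, h2⟩ := ses_of_free b M (bot_of_sub b (h 0))
    refine sub₁ _ _ hS (ih _ fun q => ?_) (subsingleton_of_injective _ _ _)
    refine sub₃ _ _ hS ?_ (h _)
    rcases q with _ | q
    · exact zero_sub _ h2
    · exact subsingleton_of_injective _ _ _

theorem corner (a b : Ideal R) (d : ℕ) : ∀ (M : ModuleCat.{0} R) (c : ℕ),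
    (∀ p > c, ∀ q ≤ d, Subsingleton (L a p (L b q M))) → (∀ q > d, Subsingleton (L b q M)) →
    Nonempty (L (a + b) (c + d) M ≃ₗ[R] L a c (L b d M)) := by
  induction d with
  | zero =>
    intro M c h1 h2
    obtain ⟨S, hS, hS1, rfl, h3⟩ := ses_tors b M
    have hT : Γ b S.X₁ = ⊤ := by rw [hS1]; exact Γ_Γ _ _
    have hq : ∀ q, Subsingleton (L b q S.X₃) := by
      intro q
      rcases q with _ | q
      · exact zero_sub _ h3
      · exact sub₃ _ _ hS (h2 _ (by omega)) (tors_acyclic _ _ _ hT)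
    refine ⟨((fEquiv (a + b) (c + 0) hS (fun n => free_all _ _ _ _ hq)).symm.trans
      (torsEquiv _ _ _ _ hT)).trans (mapEquiv a c (eqToIso hS1 ≪≫ 
        (zeroEquiv b S.X₂).toModuleIso.symm))⟩
  | succ d ih =>
    intro M c h1 h2
    obtain ⟨S, hS, hS1, rfl, h3⟩ := ses_tors b M
    have hT : Γ b S.X₁ = ⊤ := by rw [hS1]; exact Γ_Γ _ _
    have hv : ∀ n > c, Subsingleton (L (a + b) n S.X₁) := by
      intro n hn
      have := h1 n hn 0 (by omega)
      exact ((torsEquiv a b n _ hT).trans (mapEquiv a n (eqToIso hS1 ≪≫ 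
        (zeroEquiv b S.X₂).toModuleIso.symm))).toEquiv.subsingleton
    obtain ⟨T, hTe, hT1, hI, hTf⟩ := ses_of_free b S.X₃ h3
    have hb : ∀ q, Subsingleton (L b q T.X₂) := by
      intro q
      rcases q with _ | q
      · exact zero_sub _ hTf
      · exact subsingleton_of_injective _ _ _
    -- identify
    have e : ∀ q, Nonempty (L b q T.X₃ ≃ₗ[R] L b (q + 1) S.X₂) := fun q => 
      ⟨((shiftEquiv b q hTe (hb _) (hb _)).trans (mapEquiv b (q + 1) (eqToIso hT1))).trans
        (gEquiv b (q + 1) hS (tors_acyclic _ _ _ hT) (tors_acyclic _ _ _ hT)).symm⟩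
    have hab : ∀ q, Subsingleton (L (a + b) q T.X₂) := fun q => free_all _ _ _ _ hb
    have e' : L (a + b) (c + d) T.X₃ ≃ₗ[R] L (a + b) (c + d + 1) S.X₂ :=
      ((shiftEquiv (a + b) _ hTe (hab _) (hab _)).trans (mapEquiv (a + b) _ (eqToIso hT1))).trans
        (gEquiv (a + b) _ hS (hv _ (by omega)) (hv _ (by omega))).symm
    obtain ⟨k⟩ := ih T.X₃ c (by
      intro p hp q hq
      have := h1 p hp (q + 1) (by omega)
      exact (mapEquiv a p (e q).some.toModuleIso).toEquiv.subsingleton) (by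
      intro q hq
      have := h2 (q + 1) (by omega)
      exact (e q).some.toEquiv.subsingleton)
    exact ⟨(e'.symm.trans k).trans (mapEquiv a c (e d).some.toModuleIso)⟩

lemma sub_of_corner (a b : Ideal R) (c d : ℕ) 
    (h1 : ∀ p > c, ∀ X, Subsingleton (L a p X)) (h2 : ∀ q > d, ∀ X, Subsingleton (L b q X))
    (n : ℕ) (hn : c + d < n) (X : ModuleCat.{0} R) : Subsingleton (L (a + b) n X) := by
  obtain ⟨k, rfl⟩ : ∃ k, n = k + d := ⟨n - d, by omega⟩
  obtain ⟨e⟩ := corner a b d X k (fun p hp q _ => h1 _ (by omega) _) (fun q hq => h2 _ hq _)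
  have := h1 k (by omega) (L b d X)
  exact e.toEquiv.subsingleton

lemma ses_inj (X : ModuleCat.{0} R) : ∃ S : ShortComplex (ModuleCat.{0} R),
    S.ShortExact ∧ S.X₁ = X ∧ Injective S.X₂ := by
  obtain ⟨I, _, _, f, hI, hf⟩ := exists_emb X
  exact ⟨_, sc_exact f (LinearMap.range f).mkQ (LinearMap.exact_map_mkQ_range f) hf
      (Submodule.mkQ_surjective _), rfl, (Module.injective_iff_injective_object R _).1 hI⟩

lemma principal₂ (x : R) (X : ModuleCat.{0} R) : Subsingleton (L (Ideal.span {x}) 2 X) := by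
  set a := Ideal.span {x} with ha
  have hxinj : ∀ (W : ModuleCat.{0} R), Γ a W = ⊥ → Function.Injective (fun y : W => x • y) := by
    intro W hW
    change Function.Injective (x • (LinearMap.id : W →ₗ[R] W))
    rw [injective_iff_map_eq_zero]
    intro w hw
    have : w ∈ Γ a W := ⟨1, fun r hr => by
      rw [pow_one, ha] at hr
      obtain ⟨s, rfl⟩ := Ideal.mem_span_singleton'.1 hr
      rw [mul_smul]
      have hw : x • w = 0 := hw
      rw [hw, smul_zero]⟩
    rwa [hW] at this
  obtain ⟨S, hS, hS1, rfl, h3⟩ := ses_tors a X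
  have hT : Γ a S.X₁ = ⊤ := by rw [hS1]; exact Γ_Γ _ _
  obtain ⟨T, hTe, hT1, hI, hTf⟩ := ses_of_free a S.X₃ h3
  refine sub₂ _ _ hS (tors_acyclic _ _ _ hT) ?_
  rw [← hT1]
  refine sub₁ a 1 hTe ?_ (subsingleton_of_injective _ _ _)
  obtain ⟨U, hU, hU1, hU2, h4⟩ := ses_tors a T.X₃
  have hTU : Γ a U.X₁ = ⊤ := by rw [hU1]; exact Γ_Γ _ _
  rw [← hU2]
  refine sub₂ _ _ hU (tors_acyclic _ _ _ hTU) ?_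
  refine subsingleton_of_bijective x 1 _ ⟨hxinj _ h4, fun u => ?_⟩
  have := hU.epi_g
  have := hTe.epi_g
  obtain ⟨v, rfl⟩ := (ModuleCat.epi_iff_surjective U.g).1 inferInstance u
  obtain ⟨w, hw⟩ := (ModuleCat.epi_iff_surjective T.g).1 inferInstance ((eqToHom hU2).hom v)
  have hI' : Module.Injective R T.X₂ := (Module.injective_iff_injective_object R _).2 hI
  obtain ⟨g, hg⟩ := hI'.out (x • (LinearMap.id : T.X₂ →ₗ[R] T.X₂)) (hxinj _ hTf) LinearMap.id
  have hg' : x • g w = w := by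
    rw [← map_smul]
    exact hg w
  refine ⟨U.g ((eqToHom hU2.symm).hom (T.g (g w))), ?_⟩
  change x • U.g.hom ((eqToHom hU2.symm).hom (T.g.hom (g w))) = _
  rw [← map_smul, ← map_smul, ← map_smul, hg']
  change U.g ((eqToHom hU2.symm) (T.g w)) = _
  rw [hw]
  change U.g ((eqToHom hU2 ≫ eqToHom hU2.symm) v) = _
  rw [eqToHom_trans]
  rfl

lemma principal (x : R) (i : ℕ) (hi : 1 < i) :
    ∀ X : ModuleCat.{0} R, Subsingleton (L (Ideal.span {x}) i X) := by
  induction i, hi using Nat.le_induction with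
  | base => exact principal₂ x
  | succ n hn ih =>
    intro X
    obtain ⟨S, hS, rfl, hI⟩ := ses_inj X
    exact sub₁ (Ideal.span {x}) n hS (ih _) (subsingleton_of_injective _ _ _)

theorem bounded (a : Ideal R) : ∃ c : ℕ, ∀ i > c, ∀ X : ModuleCat.{0} R, Subsingleton (L a i X) := by
  have : a.FG := IsNoetherian.noetherian a
  induction a, this using Submodule.fg_induction with
  | singleton x => exact ⟨1, fun i hi => principal x i hi⟩
  | sup a b _ _ h1 h2 =>
    obtain ⟨c, hc⟩ := h1
    obtain ⟨d, hd⟩ := h2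
    exact ⟨c + d, fun i hi => sub_of_corner a b c d hc hd i hi⟩

end main
end LC

namespace LC
open CategoryTheory.Abelian

variable {R : Type} [CommRing R]

section fg
variable [IsNoetherianRing R]

lemma ses_proj (X : ModuleCat.{0} R) [Module.Finite R X] : ∃ S : ShortComplex (ModuleCat.{0} R),
    S.ShortExact ∧ S.X₃ = X ∧ Projective S.X₂ ∧ Module.Finite R S.X₁ := by
  obtain ⟨n, p, hp⟩ := Module.Finite.exists_fin' R X
  refine ⟨_, sc_exact (LinearMap.ker p).subtype p (LinearMap.exact_subtype_ker_map p)
    (Submodule.injective_subtype _) hp, rfl, ?_, ?_⟩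
  · exact (IsProjective.iff_projective (R := R) (Fin n → R)).1 inferInstance
  · exact (inferInstance : Module.Finite R (LinearMap.ker p))

lemma ext_fg (N : ModuleCat.{0} R) (i : ℕ) : ∀ (X : ModuleCat.{0} R) [Module.Finite R X]
    (α : Ext X N i), ∃ N' : Submodule R N, N'.FG ∧ ∃ α' : Ext X (ModuleCat.of R N') i,
      α'.comp (Ext.mk₀ (ModuleCat.ofHom N'.subtype : ModuleCat.of R N' ⟶ N)) (add_zero i) = α := by
  induction i with
  | zero =>
    intro X _ α
    obtain ⟨f, rfl⟩ := (Ext.mk₀_bijective _ _).2 α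
    refine ⟨LinearMap.range f.hom, ?_, Ext.mk₀ (ModuleCat.ofHom f.hom.rangeRestrict), ?_⟩
    · rw [LinearMap.range_eq_map]
      exact Submodule.FG.map _ (Module.Finite.fg_top)
    · rw [Ext.mk₀_comp_mk₀]
      rfl
  | succ i ih =>
    intro X _ α
    obtain ⟨S, hS, rfl, hP, hF⟩ := ses_proj X
    obtain ⟨β, rfl⟩ := Ext.contravariant_sequence_exact₃ hS N α 
      (Ext.eq_zero_of_projective _) (add_comm 1 i)
    obtain ⟨N', hN', β', rfl⟩ := ih S.X₁ β
    refine ⟨N', hN', hS.extClass.comp β' (add_comm 1 i), ?_⟩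
    rw [Ext.comp_assoc]
    omega

lemma sub_of_fg (a : Ideal R) (i : ℕ) (N : ModuleCat.{0} R)
    (h : ∀ N' : Submodule R N, N'.FG → Subsingleton (L a i (ModuleCat.of R N'))) :
    Subsingleton (L a i N) := by
  refine subsingleton_of_forall_eq 0 fun z => ?_
  obtain ⟨n, x, rfl⟩ := exists_of z
  obtain ⟨N', hN', y, rfl⟩ := ext_fg N i (Q a n) x
  have := h N' hN'
  rw [← post_of a, Subsingleton.elim (of a _ i n y) 0, map_zero]

end fg

lemma sub_of_sub (a : Ideal R) (i : ℕ) (N : ModuleCat.{0} R) [Subsingleton N] :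
    Subsingleton (L a i N) := by
  refine subsingleton_of_forall_eq 0 fun z => ?_
  rw [← one_smul R z]
  exact smul_eq_zero a i N 1 (fun x => Subsingleton.elim _ _) z

/-- a nonzero map to a prime quotient in the support -/
lemma exists_map (M : Type) [AddCommGroup M] [Module R M] [Module.Finite R M] (p : Ideal R)
    [hp : p.IsPrime] (h : Module.annihilator R M ≤ p) : ∃ φ : M →ₗ[R] R ⧸ p, φ ≠ 0 := by
  have h1 : (⟨p, hp⟩ : PrimeSpectrum R) ∈ Module.support R M :=
    Module.mem_support_iff_of_finite.2 h
  rw [Module.mem_support_iff_nontrivial_residueField_tensorProduct] at h1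
  obtain ⟨v, hv⟩ := exists_ne (0 : TensorProduct R p.ResidueField M)
  obtain ⟨ψ, hψ⟩ : ∃ ψ : Module.Dual p.ResidueField (TensorProduct R p.ResidueField M), ψ v ≠ 0 := by
    by_contra! hcon
    exact hv ((Module.forall_dual_apply_eq_zero_iff p.ResidueField v).1 hcon)
  let f : M →ₗ[R] p.ResidueField := 
    (ψ.restrictScalars R) ∘ₗ (TensorProduct.mk R p.ResidueField M 1)
  have hf : ∃ m, f m ≠ 0 := by
    by_contra! hcon
    apply hψ
    clear hψ hv
    induction v using TensorProduct.induction_on with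
    | zero => simp
    | tmul x y =>
      have : x ⊗ₜ[R] y = x • ((1 : p.ResidueField) ⊗ₜ[R] y) := by simp [TensorProduct.smul_tmul']
      rw [this, map_smul]
      have := hcon y
      simp only [f, LinearMap.comp_apply, TensorProduct.mk_apply, LinearMap.restrictScalars_apply] at this
      rw [this, smul_zero]
    | add x y hx hy => rw [map_add, hx, hy, add_zero]
  obtain ⟨m, hm⟩ := hf
  obtain ⟨T, hT⟩ := (Module.Finite.fg_top : (⊤ : Submodule R M).FG)
  classical
  obtain ⟨⟨s, hs⟩, hsT⟩ := IsLocalization.exist_integer_multiples_of_finset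
    (nonZeroDivisors (R ⧸ p)) (T.image f)
  let ι : (R ⧸ p) →ₗ[R] p.ResidueField := 
    (Algebra.linearMap (R ⧸ p) p.ResidueField).restrictScalars R
  have hι : Function.Injective ι := IsFractionRing.injective (R ⧸ p) p.ResidueField
  let g : M →ₗ[R] p.ResidueField := 
    ((LinearMap.lsmul (R ⧸ p) p.ResidueField s).restrictScalars R) ∘ₗ f
  have hg : ∀ x, g x ∈ LinearMap.range ι := by
    have : (⊤ : Submodule R M) ≤ (LinearMap.range ι).comap g := by
      rw [← hT, Submodule.span_le]
      intro t ht
      obtain ⟨y, hy⟩ := hsT (f t) (Finset.mem_image_of_mem _ ht)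
      exact ⟨y, hy⟩
    exact fun x => this trivial
  refine ⟨(LinearEquiv.ofInjective ι hι).symm.toLinearMap ∘ₗ g.codRestrict _ hg, fun hcon => ?_⟩
  have h0 := LinearMap.congr_fun hcon m
  simp only [LinearMap.comp_apply, LinearEquiv.coe_coe, LinearMap.zero_apply,
    LinearEquiv.map_eq_zero_iff] at h0
  have h0 : s • f m = 0 := congrArg Subtype.val h0
  rw [Algebra.smul_def, mul_eq_zero] at h0
  rcases h0 with h0 | h0
  · have := (map_eq_zero_iff _ (IsFractionRing.injective (R ⧸ p) p.ResidueField)).1 h0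
    exact nonZeroDivisors.ne_zero hs this
  · exact hm h0

variable [IsNoetherianRing R]

lemma sub₂' (a : Ideal R) (i : ℕ) {X Y Z : Type} [AddCommGroup X] [Module R X] [AddCommGroup Y]
    [Module R Y] [AddCommGroup Z] [Module R Z] (f : X →ₗ[R] Y) (g : Y →ₗ[R] Z)
    (h : Function.Exact f g) (hf : Function.Injective f) (hg : Function.Surjective g)
    (h1 : Subsingleton (L a i (ModuleCat.of R X))) (h3 : Subsingleton (L a i (ModuleCat.of R Z))) :
    Subsingleton (L a i (ModuleCat.of R Y)) :=
  sub₂ (S := sc f g h) a i (sc_exact f g h hf hg) h1 h3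

lemma sub₃' (a : Ideal R) (i : ℕ) {X Y Z : Type} [AddCommGroup X] [Module R X] [AddCommGroup Y]
    [Module R Y] [AddCommGroup Z] [Module R Z] (f : X →ₗ[R] Y) (g : Y →ₗ[R] Z)
    (h : Function.Exact f g) (hf : Function.Injective f) (hg : Function.Surjective g)
    (h2 : Subsingleton (L a i (ModuleCat.of R Y)))
    (h1 : Subsingleton (L a (i + 1) (ModuleCat.of R X))) :
    Subsingleton (L a i (ModuleCat.of R Z)) :=
  sub₃ (S := sc f g h) a i (sc_exact f g h hf hg) h2 h1

lemma prime_step (a : Ideal R) (i : ℕ) (M : ModuleCat.{0} R) [Module.Finite R M]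
    (hM : Subsingleton (L a i M))
    (ih : ∀ N : ModuleCat.{0} R, (∀ r ∈ Module.annihilator R M, ∀ x : N, r • x = 0) →
      Subsingleton (L a (i + 1) N)) (p : Ideal R) [p.IsPrime] (h : Module.annihilator R M ≤ p)
    (hJ : ∀ J > p, ∀ N : ModuleCat.{0} R, Module.Finite R N → (∀ r ∈ J, ∀ x : N, r • x = 0) →
      Subsingleton (L a i N)) : Subsingleton (L a i (ModuleCat.of R (R ⧸ p))) := by
  obtain ⟨φ, hφ⟩ := exists_map M p h
  have h1 : Subsingleton (L a i (ModuleCat.of R (LinearMap.range φ))) := by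
    refine sub₃' a i (LinearMap.ker φ).subtype φ.rangeRestrict (by
      rw [LinearMap.exact_iff, LinearMap.ker_rangeRestrict, Submodule.range_subtype])
      (Submodule.injective_subtype _) φ.surjective_rangeRestrict hM
      (ih (ModuleCat.of R (LinearMap.ker φ)) ?_)
    rintro r hr ⟨x, hx⟩
    exact Subtype.ext (Module.mem_annihilator.1 hr x)
  refine sub₂' a i (LinearMap.range φ).subtype (LinearMap.range φ).mkQ
    (LinearMap.exact_subtype_mkQ _)
    (Submodule.injective_subtype _) (Submodule.mkQ_surjective _) h1 (hJ ((LinearMap.range φ).comap p.mkQ) ?_ 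
    (ModuleCat.of R ((R ⧸ p) ⧸ LinearMap.range φ)) ?_ ?_)
  · refine lt_of_le_of_ne ?_ ?_
    · intro r hr
      have : p.mkQ r = 0 := (Submodule.Quotient.mk_eq_zero _).2 hr
      rw [Submodule.mem_comap, this]
      exact zero_mem _
    · intro hcon
      apply hφ
      ext m
      obtain ⟨s, hs⟩ := p.mkQ_surjective (φ m)
      have : s ∈ (LinearMap.range φ).comap p.mkQ := ⟨m, hs.symm⟩
      rw [← hcon] at this
      rw [← hs, LinearMap.zero_apply]
      exact (Submodule.Quotient.mk_eq_zero _).2 this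
  · exact (inferInstance : Module.Finite R ((R ⧸ p) ⧸ LinearMap.range φ))
  · intro r hr x
    obtain ⟨x, rfl⟩ := (LinearMap.range φ).mkQ_surjective x
    obtain ⟨s, rfl⟩ := p.mkQ_surjective x
    change (LinearMap.range φ).mkQ (p.mkQ (r • s)) = 0
    have : r • s = s • r := mul_comm _ _
    rw [this, map_smul]
    exact (Submodule.Quotient.mk_eq_zero _).2 (Submodule.smul_mem _ _ hr)

lemma fg_step (a : Ideal R) (i : ℕ) (M : ModuleCat.{0} R) [Module.Finite R M]
    (hM : Subsingleton (L a i M))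
    (ih : ∀ N : ModuleCat.{0} R, (∀ r ∈ Module.annihilator R M, ∀ x : N, r • x = 0) →
      Subsingleton (L a (i + 1) N)) (J : Ideal R) : Module.annihilator R M ≤ J →
      ∀ N : ModuleCat.{0} R, Module.Finite R N → (∀ r ∈ J, ∀ x : N, r • x = 0) →
      Subsingleton (L a i N) := by
  induction J using IsNoetherian.induction with
  | hgt J hJ =>
  intro hMJ N hN
  refine IsNoetherianRing.induction_on_isQuotientEquivQuotientPrime R hN
    (motive := fun N _ _ _ => (∀ r ∈ J, ∀ x : N, r • x = 0) →
      Subsingleton (L a i (ModuleCat.of R N))) ?_ ?_ ?_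
  · intro N _ _ _ _ _
    exact @sub_of_sub _ _ a i (ModuleCat.of R N) (inferInstance : Subsingleton N)
  · intro N _ _ hF p e hkill
    have hp : p.1.IsPrime := p.2
    suffices Subsingleton (L a i (ModuleCat.of R (R ⧸ p.1))) from
      (mapEquiv a i e.toModuleIso).toEquiv.subsingleton
    have hle : J ≤ p.1 := by
      intro r hr
      have := hkill r hr (e.symm (Submodule.Quotient.mk 1))
      rw [← map_smul, LinearEquiv.map_eq_zero_iff, ← Submodule.Quotient.mk_smul,
        Submodule.Quotient.mk_eq_zero] at this
      simpa using this
    exact prime_step a i M hM ih p.1 (hMJ.trans hle) 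
      (fun K hK => hJ K (lt_of_le_of_lt hle hK) (hMJ.trans (hle.trans hK.le)))
  · intro N₁ _ _ _ N₂ _ _ _ N₃ _ _ _ f g hf hg hfg h1 h3 hkill
    refine sub₂' a i f g hfg hf hg (h1 ?_) (h3 ?_)
    · intro r hr x
      exact hf (by rw [map_smul, hkill r hr, map_zero])
    · intro r hr x
      obtain ⟨x, rfl⟩ := hg x
      rw [← map_smul, hkill r hr, map_zero]

theorem cd_le (a : Ideal R) (M : ModuleCat.{0} R) [Module.Finite R M] (c : ℕ)
    (hM : ∀ i > c, Subsingleton (L a i M)) (i : ℕ) (hi : i > c) (N : ModuleCat.{0} R)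
    (hN : ∀ r ∈ Module.annihilator R M, ∀ x : N, r • x = 0) : Subsingleton (L a i N) := by
  obtain ⟨C, hC⟩ := bounded a
  have key : ∀ k i, i > c → i + k > C → ∀ N : ModuleCat.{0} R, 
      (∀ r ∈ Module.annihilator R M, ∀ x : N, r • x = 0) → Subsingleton (L a i N) := by
    intro k
    induction k with
    | zero => exact fun i _ h N _ => hC i h N
    | succ k ih =>
      intro i hi hk N hN
      refine sub_of_fg a i N fun N' hN' => ?_
      refine fg_step a i M (hM i hi) (ih (i + 1) (by omega) (by omega)) _ le_rfl _ 
        (Module.Finite.iff_fg.2 hN') ?_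
      rintro r hr ⟨x, hx⟩
      exact Subtype.ext (hN r hr x)
  exact key (C + 1) i hi (by omega) N hN

/-- The main result in terms of the model. -/
theorem model (a b : Ideal R) (M : ModuleCat.{0} R) [Module.Finite R M] (c d : ℕ)
    (hc : ∀ i > c, Subsingleton (L a i M)) (hd : ∀ i > d, Subsingleton (L b i M)) :
    Nonempty (L (a + b) (c + d) M ≃ₗ[R] L a c (L b d M)) :=
  corner a b d M c (fun p hp q _ => cd_le a M c hc p hp _ (fun r hr x => 
    smul_eq_zero b q M r (Module.mem_annihilator.1 hr) x)) hd

end LC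

namespace LC
open CategoryTheory.Abelian

variable {R : Type} [CommRing R]

abbrev Res (A : ModuleCat.{0} R) := ProjectiveResolution A

/-- hom complex -/
noncomputable abbrev K {A : ModuleCat.{0} R} (P : ProjectiveResolution A) (X : ModuleCat.{0} R) :
    CochainComplex (ModuleCat.{0} R) ℕ := P.complex.linearYonedaObj R X

/-- map on hom complexes -/
noncomputable def Kmap {A A' : ModuleCat.{0} R} (P : ProjectiveResolution A) 
    (P' : ProjectiveResolution A') (φ : P.complex ⟶ P'.complex) (X : ModuleCat.{0} R) :
    K P' X ⟶ K P X :=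
  (HomologicalComplex.unopFunctor _ _).map
    (((((linearYoneda R (ModuleCat.{0} R)).obj X).rightOp.mapHomologicalComplex _).map φ).op)

lemma Kmap_f {A A' : ModuleCat.{0} R} (P : ProjectiveResolution A) 
    (P' : ProjectiveResolution A') (φ : P.complex ⟶ P'.complex) (X : ModuleCat.{0} R) (n : ℕ)
    (f : P'.complex.X n ⟶ X) : (Kmap P P' φ X).f n f = φ.f n ≫ f := rfl

lemma K_d {A : ModuleCat.{0} R} (P : ProjectiveResolution A) (X : ModuleCat.{0} R) (n m : ℕ)
    (f : P.complex.X n ⟶ X) : (K P X).d n m f = P.complex.d m n ≫ f := rfl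

lemma homologyUnop_nat {V : Type 1} [Category.{0} V] [Abelian V] {c : ComplexShape ℕ} 
    (K L : HomologicalComplex Vᵒᵖ c) (φ : K ⟶ L) (n : ℕ) :
    HomologicalComplex.homologyMap ((HomologicalComplex.unopFunctor _ _).map φ.op) n ≫ 
      (K.homologyUnop n).hom =
      (L.homologyUnop n).hom ≫ (HomologicalComplex.homologyMap φ n).unop := by
  have := HomologicalComplex.homologyOp_hom_naturality
    ((HomologicalComplex.unopFunctor _ _).map φ.op) n
  have h2 := congrArg Quiver.Hom.unop this
  exact h2.symm

lemma sq {V : Type 1} [Category.{0} V] {a b c d : V} (e : a ≅ b) (e' : c ≅ d) (f : a ⟶ c)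
    (h : b ⟶ d) (hh : f ≫ e'.hom = e.hom ≫ h) : h ≫ e'.inv = e.inv ≫ f := by
  rw [Iso.comp_inv_eq, Category.assoc, hh, Iso.inv_hom_id_assoc]

lemma paste {V : Type 1} [Category.{0} V] {a b c a' b' c' : V} (m : a ⟶ a') (p : a' ⟶ b')
    (q : b' ⟶ c') (p' : a ⟶ b) (q' : b ⟶ c) (h : b ⟶ b') (k : c ⟶ c') (h1 : m ≫ p = p' ≫ h)
    (h2 : h ≫ q = q' ≫ k) : m ≫ (p ≫ q) = (p' ≫ q') ≫ k := by
  rw [← Category.assoc, h1, Category.assoc, h2, Category.assoc]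

lemma isoExt_nat {A A' : ModuleCat.{0} R} (g : A ⟶ A') (P : ProjectiveResolution A) 
    (P' : ProjectiveResolution A') (φ : P.complex ⟶ P'.complex)
    (comm : φ.f 0 ≫ P'.π.f 0 = P.π.f 0 ≫ g) (X : ModuleCat.{0} R) (n : ℕ) :
    ((_root_.Ext R (ModuleCat.{0} R) n).map g.op).app X ≫ (P.isoExt n X).hom =
      (P'.isoExt n X).hom ≫ HomologicalComplex.homologyMap (Kmap P P' φ X) n := by
  have h1 := congrArg Quiver.Hom.unop (P.isoLeftDerivedObj_inv_naturality g P' φ comm 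
    ((linearYoneda R (ModuleCat.{0} R)).obj X).rightOp n)
  have h2 := homologyUnop_nat _ _
    ((((linearYoneda R (ModuleCat.{0} R)).obj X).rightOp.mapHomologicalComplex
      (ComplexShape.down ℕ)).map φ) n
  have h3 := sq (HomologicalComplex.homologyUnop _ n) (HomologicalComplex.homologyUnop _ n) _ _ h2
  exact paste _ _ _ _ _ _ _ h1 h3

end LC

namespace LC
open CategoryTheory.Abelian

variable {R : Type} [CommRing R]

section
variable {A : ModuleCat.{0} R} (P : ProjectiveResolution A) (X : ModuleCat.{0} R)

open CochainComplex HomComplex in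
lemma extMk_zero_iff₀ (f : P.complex.X 0 ⟶ X) (hf : P.complex.d 1 0 ≫ f = 0) :
    P.extMk f 1 rfl hf = 0 ↔ f = 0 := by
  constructor
  · intro h
    rw [← P.extEquivCohomologyClass.apply_eq_iff_eq, P.extEquivCohomologyClass_extMk,
      P.extEquivCohomologyClass_zero, CohomologyClass.mk_eq_zero_iff,
      Cocycle.toSingleMk_mem_coboundaries_iff _ _ _ _ _ 1 (by simp)] at h
    obtain ⟨g, hg⟩ := h
    have h0 : g = 0 := 
      (CochainComplex.isZero_of_isStrictlyLE P.cochainComplex 0 1 (by simp)).eq_of_src _ _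
    rw [h0, Limits.comp_zero] at hg
    rw [← cancel_epi (P.cochainComplexXIso (-(0:ℕ)) 0 rfl).hom, ← hg, Limits.comp_zero]
  · rintro rfl
    simp

lemma extMk_zero_iff (n : ℕ) (f : P.complex.X n ⟶ X) (hf : P.complex.d (n + 1) n ≫ f = 0) :
    P.extMk f (n + 1) rfl hf = 0 ↔ 
      ∃ g : P.complex.X ((ComplexShape.up ℕ).prev n) ⟶ X, P.complex.d n _ ≫ g = f := by
  rcases n with _ | n
  · rw [extMk_zero_iff₀]
    have h0 : (ComplexShape.up ℕ).prev 0 = 0 := by simp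
    rw [h0]
    constructor
    · rintro rfl
      exact ⟨0, by simp⟩
    · rintro ⟨g, rfl⟩
      rw [HomologicalComplex.shape _ _ _ (by simp), Limits.zero_comp]
  · have h0 : (ComplexShape.up ℕ).prev (n + 1) = n := by simp
    rw [h0]
    exact P.extMk_eq_zero_iff f _ rfl hf n rfl

lemma smul_extMk (r : R) (n : ℕ) (f : P.complex.X n ⟶ X) (hf : P.complex.d (n + 1) n ≫ f = 0) :
    r • P.extMk f (n + 1) rfl hf = P.extMk (r • f) (n + 1) rfl (by simp [hf]) := by
  rw [Ext.smul_eq_comp_mk₀, P.extMk_comp_mk₀]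
  congr 1

lemma extMk_congr (n : ℕ) (f g : P.complex.X n ⟶ X) (h : f = g)
    (hf : P.complex.d (n + 1) n ≫ f = 0) (hg : P.complex.d (n + 1) n ≫ g = 0) :
    P.extMk f (n + 1) rfl hf = P.extMk g (n + 1) rfl hg := by
  subst h
  rfl

lemma cyc (n : ℕ) (z : (K P X).cycles n) :
    P.complex.d (n + 1) n ≫ ((K P X).iCycles n z : P.complex.X n ⟶ X) = 0 :=
  congrArg (fun t => t.hom z) ((K P X).iCycles_d n (n + 1))

/-- from cocycles to Ext -/
noncomputable def vmap (n : ℕ) : (K P X).cycles n →ₗ[R] Ext A X n where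
  toFun z := P.extMk ((K P X).iCycles n z : P.complex.X n ⟶ X) (n + 1) rfl (cyc P X n z)
  map_add' z w :=
    (extMk_congr P X n _ _ (map_add ((K P X).iCycles n).hom z w) (cyc P X n (z + w))
      (by
        refine (Preadditive.comp_add _ _ _ _ _ _).trans ?_
        exact (congrArg₂ (· + ·) (cyc P X n z) (cyc P X n w)).trans (add_zero _))).trans
      (P.add_extMk _ _ _ rfl (cyc P X n z) (cyc P X n w)).symm
  map_smul' r z :=
    (extMk_congr P X n _ _ (map_smul ((K P X).iCycles n).hom r z) (cyc P X n (r • z))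
      (by
        refine (Linear.comp_smul _ _ _ _ _ _).trans ?_
        exact (congrArg (r • ·) (cyc P X n z)).trans (smul_zero _))).trans
      (smul_extMk P X r n _ (cyc P X n z)).symm

lemma vmap_surjective (n : ℕ) : Function.Surjective (vmap P X n) := by
  intro α
  obtain ⟨f, hf, rfl⟩ := P.extMk_surjective α (n + 1) rfl
  have hex := ShortComplex.exact_of_f_is_kernel
    (ShortComplex.mk _ _ ((K P X).iCycles_d n (n + 1))) ((K P X).cyclesIsKernel n (n + 1) (by simp))
  rw [ShortComplex.ShortExact.moduleCat_exact_iff_function_exact] at hex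
  obtain ⟨z, hz⟩ := (hex f).1 hf
  exact ⟨z, extMk_congr P X n _ _ hz (cyc P X n z) hf⟩

lemma vmap_zero_iff (n : ℕ) (z : (K P X).cycles n) :
    vmap P X n z = 0 ↔ (K P X).homologyπ n z = 0 := by
  have hex := ShortComplex.exact_of_g_is_cokernel
    (ShortComplex.mk _ _ ((K P X).toCycles_comp_homologyπ _ n))
    ((K P X).homologyIsCokernel _ n rfl)
  rw [ShortComplex.ShortExact.moduleCat_exact_iff_function_exact] at hex
  refine (extMk_zero_iff P X n _ (cyc P X n z)).trans (Iff.trans ?_ (hex z).symm)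
  constructor
  · rintro ⟨g, hg⟩
    refine ⟨g, ?_⟩
    apply (ModuleCat.mono_iff_injective ((K P X).iCycles n)).1 inferInstance
    refine Eq.trans ?_ hg
    exact congrArg (fun t => t.hom g) ((K P X).toCycles_i _ n)
  · rintro ⟨g, rfl⟩
    refine ⟨g, ?_⟩
    exact (congrArg (fun t => t.hom g) ((K P X).toCycles_i _ n)).symm

lemma hπ_surjective (n : ℕ) : Function.Surjective ((K P X).homologyπ n).hom :=
  (ModuleCat.epi_iff_surjective _).1 inferInstance

/-- homology and Ext -/
noncomputable def eH (n : ℕ) : (K P X).homology n ≃ₗ[R] Ext A X n :=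
  (((K P X).homologyπ n).hom.quotKerEquivOfSurjective (hπ_surjective P X n)).symm.trans
    ((Submodule.quotEquivOfEq _ _ (by
      ext z
      exact (vmap_zero_iff P X n z).symm)).trans
      ((vmap P X n).quotKerEquivOfSurjective (vmap_surjective P X n)))

lemma eH_π (n : ℕ) (z : (K P X).cycles n) :
    eH P X n ((K P X).homologyπ n z) = vmap P X n z := by
  have : (((K P X).homologyπ n).hom.quotKerEquivOfSurjective (hπ_surjective P X n)).symm
      ((K P X).homologyπ n z) = Submodule.Quotient.mk z := by
    rw [LinearEquiv.symm_apply_eq]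
    rfl
  rw [eH, LinearEquiv.trans_apply, this]
  rfl

lemma eH_nat {A' : ModuleCat.{0} R} (P' : ProjectiveResolution A') (g : A ⟶ A')
    (φ : ProjectiveResolution.Hom P P' g) (n : ℕ) (y : (K P' X).homology n) :
    eH P X n (HomologicalComplex.homologyMap (Kmap P P' φ.hom X) n y) =
      (Ext.mk₀ g).comp (eH P' X n y) (zero_add n) := by
  obtain ⟨z, rfl⟩ := hπ_surjective P' X n y
  have h1 : HomologicalComplex.homologyMap (Kmap P P' φ.hom X) n ((K P' X).homologyπ n z) =
    (K P X).homologyπ n (HomologicalComplex.cyclesMap (Kmap P P' φ.hom X) n z) :=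
    congrArg (fun t => t.hom z) (HomologicalComplex.homologyπ_naturality (Kmap P P' φ.hom X) n)
  refine (congrArg (eH P X n) h1).trans ?_
  rw [eH_π]
  have h2 := eH_π P' X n z
  refine Eq.trans ?_ (congrArg (fun t => (Ext.mk₀ g).comp t (zero_add n)) h2.symm)
  refine Eq.trans ?_ (ProjectiveResolution.mk₀_comp_extMk _ _ rfl (cyc P' X n z) φ).symm
  refine extMk_congr P X n _ _ ?_ (cyc P X n _) _
  exact congrArg (fun t => t.hom z) (HomologicalComplex.cyclesMap_i (Kmap P P' φ.hom X) n)

end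

/-- old Ext and new Ext, via a resolution -/
noncomputable def eE' {A : ModuleCat.{0} R} (P : ProjectiveResolution A) (X : ModuleCat.{0} R)
    (n : ℕ) :
    ((_root_.Ext R (ModuleCat.{0} R) n).obj (Opposite.op A)).obj X ≃ₗ[R] Ext A X n :=
  (P.isoExt n X).toLinearEquiv.trans (eH P X n)

lemma eE'_apply {A : ModuleCat.{0} R} (P : ProjectiveResolution A) (X : ModuleCat.{0} R)
    (n : ℕ) (y : ((_root_.Ext R (ModuleCat.{0} R) n).obj (Opposite.op A)).obj X) :
    eE' P X n y = eH P X n ((P.isoExt n X).hom.hom y) := rfl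

lemma comp_congr {U V W Z : ModuleCat.{0} R} {f : U ⟶ V} {g : V ⟶ W} {h : U ⟶ Z} {k : Z ⟶ W}
    (e : f ≫ g = h ≫ k) (y : U) : g.hom (f.hom y) = k.hom (h.hom y) :=
  congrArg (fun t => t.hom y) e

lemma eE'_nat {A A' : ModuleCat.{0} R} (P : ProjectiveResolution A)
    (P' : ProjectiveResolution A') (g : A ⟶ A') (φ : ProjectiveResolution.Hom P P' g)
    (X : ModuleCat.{0} R) (n : ℕ)
    (y : ((_root_.Ext R (ModuleCat.{0} R) n).obj (Opposite.op A')).obj X) :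
    eE' P X n ((((_root_.Ext R (ModuleCat.{0} R) n).map g.op).app X).hom y) =
      (Ext.mk₀ g).comp (eE' P' X n y) (zero_add n) := by
  have h := isoExt_nat g P P' φ.hom (φ.hom_f_zero_comp_π_f_zero) X n
  have h1 := comp_congr h y
  rw [eE'_apply, eE'_apply]
  refine Eq.trans (congrArg (eH P X n) h1) ?_
  exact eH_nat P X P' g φ n ((P'.isoExt n X).hom y)

/-- old Ext and new Ext -/
noncomputable def eE (A X : ModuleCat.{0} R) (n : ℕ) :
    ((_root_.Ext R (ModuleCat.{0} R) n).obj (Opposite.op A)).obj X ≃ₗ[R] Ext A X n :=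
  eE' (projectiveResolution A) X n

lemma eE_nat {A A' : ModuleCat.{0} R} (g : A ⟶ A') (X : ModuleCat.{0} R) (n : ℕ)
    (y : ((_root_.Ext R (ModuleCat.{0} R) n).obj (Opposite.op A')).obj X) :
    eE A X n ((((_root_.Ext R (ModuleCat.{0} R) n).map g.op).app X).hom y) =
      (Ext.mk₀ g).comp (eE A' X n y) (zero_add n) :=
  eE'_nat _ _ g ⟨ProjectiveResolution.lift g _ _, by
    simpa using ProjectiveResolution.lift_commutes_zero g _ _⟩ X n y

end LC

namespace LC
open CategoryTheory.Abelian

variable {R : Type} [CommRing R]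

lemma colim_iso (F : ℕᵒᵖᵒᵖ ⥤ ModuleCat.{0} R) (a : Ideal R) (i : ℕ) (X : ModuleCat.{0} R)
    (e : ∀ n : ℕ, F.obj (Opposite.op (Opposite.op n)) ≃ₗ[R] Ext (Q a n) X i)
    (he : ∀ (m n : ℕ) (h : m ≤ n) (x : F.obj (Opposite.op (Opposite.op m))),
      e n ((F.map (homOfLE h).op.op).hom x) = tr a X i m n h (e m x))
    (c : Limits.Cocone F) (hc : Limits.IsColimit c) : Nonempty (c.pt ≅ L a i X) := by
  have hmap : ∀ {p q : ℕᵒᵖᵒᵖ} (w : p ⟶ q), ∃ h : p.unop.unop ≤ q.unop.unop,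
      F.map w = F.map (homOfLE h).op.op := by
    intro p q w
    exact ⟨leOfHom w.unop.unop, rfl⟩
  let c' : Limits.Cocone F :=
    { pt := L a i X
      ι :=
        { app := fun p => ModuleCat.ofHom ((of a X i p.unop.unop).comp
            (e p.unop.unop).toLinearMap)
          naturality := by
            intro p q w
            obtain ⟨h, hw⟩ := hmap w
            rw [hw]
            ext x
            have h1 := he _ _ h x
            have h2 := of_tr h (e _ x)
            exact (congrArg (of a X i q.unop.unop) h1).trans h2 } }
  let lf (s : Limits.Cocone F) : L a i X →ₗ[R] s.pt :=
    Module.DirectLimit.lift R ℕ (fun n => Ext (Q a n) X i) (tr a X i)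
      (fun n => (s.ι.app (Opposite.op (Opposite.op n))).hom.comp (e n).symm.toLinearMap) (by
        intro m n h x
        obtain ⟨y, rfl⟩ := (e m).surjective x
        rw [← he]
        simp only [LinearMap.comp_apply, LinearEquiv.coe_coe, LinearEquiv.symm_apply_apply]
        exact congrArg (fun t => t.hom y) (s.w (homOfLE h).op.op))
  have hlf : ∀ s n x, lf s (of a X i n x) =
      (s.ι.app (Opposite.op (Opposite.op n))).hom ((e n).symm x) := by
    intro s n x
    exact Module.DirectLimit.lift_of _ _ _
  have hc' : Limits.IsColimit c' :=
    { desc := fun s => ModuleCat.ofHom (lf s)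
      fac := by
        intro s p
        ext x
        refine (hlf s p.unop.unop (e _ x)).trans ?_
        rw [LinearEquiv.symm_apply_apply]
      uniq := by
        intro s m hm
        ext z
        obtain ⟨n, x, rfl⟩ := exists_of z
        refine Eq.trans ?_ (hlf s n x).symm
        rw [← hm]
        change _ = m.hom (of a X i n (e n ((e n).symm x)))
        rw [LinearEquiv.apply_symm_apply] }
  exact ⟨hc.coconePointUniqueUpToIso hc'⟩

lemma lc_iso (a : Ideal R) (i : ℕ) (X : ModuleCat.{0} R) :
    Nonempty ((localCohomology a i).obj X ≅ L a i X) := by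
  have := localCohomology.hasColimitDiagram.{0, 0} (localCohomology.idealPowersDiagram a) i
  let D := localCohomology.diagram (localCohomology.idealPowersDiagram a) i
  have hc := Limits.isColimitOfPreserves ((evaluation (ModuleCat.{0} R) (ModuleCat.{0} R)).obj X)
    (Limits.colimit.isColimit D)
  exact colim_iso _ a i X (fun n => eE (Q a n) X i)
    (fun m n h x => eE_nat (pr (Ideal.pow_le_pow_right h)) X i x) _ hc

end LC

lemma LC.subsingleton_of_cohDim {R : Type} [CommRing R] [IsNoetherianRing R] (a : Ideal R)
    (M : ModuleCat.{0} R) (i : ℕ) (hi : i > cohDim a M) : Subsingleton (LC.L a i M) := by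
  obtain ⟨c, hc⟩ := LC.bounded a
  have key : ∀ j, Nontrivial ((localCohomology a j).obj M) ↔ ¬ Subsingleton (LC.L a j M) := by
    intro j
    obtain ⟨e⟩ := LC.lc_iso a j M
    rw [not_subsingleton_iff_nontrivial]
    exact e.toLinearEquiv.toEquiv.nontrivial_congr
  by_contra h
  have hb : BddAbove {i : ℕ | Nontrivial ((localCohomology a i).obj M)} := by
    refine ⟨c, fun j hj => ?_⟩
    by_contra hcj
    exact (key j).1 hj (hc j (by omega) M)
  have := le_csSup hb (show i ∈ {i : ℕ | Nontrivial ((localCohomology a i).obj M)} from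
    (key i).2 h)
  exact absurd this (not_le.2 hi)

/-- Let `R` be a commutative noetherian ring, `a, b` ideals of `R` and `M` a
finitely generated `R`-module with `(a+b)M ≠ M`.  Then
`H^{cd(a,M)+cd(b,M)}_{a+b}(M) ≅ H^{cd(a,M)}_a(H^{cd(b,M)}_b(M))`. -/
theorem statement7 {R : Type} [CommRing R] [IsNoetherianRing R] (a b : Ideal R)
    (M : ModuleCat R) [Module.Finite R M]
    (hM : (a + b) • (⊤ : Submodule R M) ≠ ⊤) :
    Nonempty ((localCohomology (a + b) (cohDim a M + cohDim b M)).obj M ≅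
      (localCohomology a (cohDim a M)).obj ((localCohomology b (cohDim b M)).obj M)) := by
  obtain ⟨e⟩ := LC.model a b M (cohDim a M) (cohDim b M) (LC.subsingleton_of_cohDim a M)
    (LC.subsingleton_of_cohDim b M)
  obtain ⟨e1⟩ := LC.lc_iso (a + b) (cohDim a M + cohDim b M) M
  obtain ⟨e2⟩ := LC.lc_iso b (cohDim b M) M
  obtain ⟨e3⟩ := LC.lc_iso a (cohDim a M) (LC.L b (cohDim b M) M)
  exact ⟨e1 ≪≫ e.toModuleIso ≪≫ e3.symm ≪≫ (localCohomology a (cohDim a M)).mapIso e2.symm⟩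
end

section
/- Let R be a commutative noetherian ring, let a and b be ideals of R, and let X be an arbitrary R-module. Then H^{ara(a)+cd(b,X)}_{a+b}(X) ≅ H^{ara(a)}_a(H^{cd(b,X)}_b(X)). Moreover, cd(a+b, X) = ara(a) + cd(b, X) if and only if ara(a) = cd(a, H^{cd(b,X)}_b(X)). -/
open CategoryTheory

/-- The arithmetic rank `ara(a)`: the least number of elements of `R` generating an ideal with
the same radical as `a`. -/
noncomputable def araRank {R : Type} [CommRing R] (a : Ideal R) : ℕ :=
  sInf {n : ℕ | ∃ f : Fin n → R, (Ideal.span (Set.range f)).radical = a.radical}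

open Limits

section partone
variable {C D : Type*} [Category* C] [Category* D] [Abelian C] [Abelian D] [EnoughProjectives C]
  {F G H : C ⥤ D} [F.Additive] [G.Additive] [H.Additive] (α : F ⟶ G) (β : G ⟶ H)
  (w : α ≫ β = 0)

/-- The short complex of complexes attached to a chain complex. -/
noncomputable def ldSC (P : ChainComplex C ℕ) : ShortComplex (ChainComplex D ℕ) :=
  ShortComplex.mk ((NatTrans.mapHomologicalComplex α _).app P)
    ((NatTrans.mapHomologicalComplex β _).app P) (by
      ext n
      exact congrArg (fun t => t.app (P.X n)) w)

/-- Functoriality. -/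
noncomputable def ldSCMap {P Q : ChainComplex C ℕ} (f : P ⟶ Q) : ldSC α β w P ⟶ ldSC α β w Q where
  τ₁ := (F.mapHomologicalComplex _).map f
  τ₂ := (G.mapHomologicalComplex _).map f
  τ₃ := (H.mapHomologicalComplex _).map f
  comm₁₂ := by simp [ldSC]
  comm₂₃ := by simp [ldSC]

variable (hse : ∀ (P : C) [Projective P], (ShortComplex.mk (α.app P) (β.app P)
    (by rw [← NatTrans.comp_app, w]; rfl)).ShortExact)

include hse in
theorem ldSC_shortExact (P : ChainComplex C ℕ) [∀ n, Projective (P.X n)] :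
    (ldSC α β w P).ShortExact := by
  apply HomologicalComplex.shortExact_of_degreewise_shortExact
  intro n
  exact hse (P.X n)


/-- The connecting map, with the type adjusted. -/
noncomputable def ldd (P : ChainComplex C ℕ) [∀ n, Projective (P.X n)] (n : ℕ) :
    (HomologicalComplex.homologyFunctor D _ (n+1)).obj ((H.mapHomologicalComplex _).obj P) ⟶
    (HomologicalComplex.homologyFunctor D _ n).obj ((F.mapHomologicalComplex _).obj P) :=
  (ldSC_shortExact α β w hse P).δ (n+1) n (by simp)

theorem ldd_naturality (P Q : ChainComplex C ℕ) [∀ n, Projective (P.X n)]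
    [∀ n, Projective (Q.X n)] (φ : P ⟶ Q) (n : ℕ) :
    ldd α β w hse P n ≫
      (F.mapHomologicalComplex _ ⋙ HomologicalComplex.homologyFunctor _ _ n).map φ =
    (H.mapHomologicalComplex _ ⋙ HomologicalComplex.homologyFunctor _ _ (n+1)).map φ ≫
      ldd α β w hse Q n :=
  HomologicalComplex.HomologySequence.δ_naturality (ldSCMap α β w φ)
      (ldSC_shortExact α β w hse P) (ldSC_shortExact α β w hse Q) (n+1) n (by simp)

theorem ldd_comp (P : ChainComplex C ℕ) [∀ n, Projective (P.X n)] (n : ℕ) :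
    ldd α β w hse P n ≫ (HomologicalComplex.homologyFunctor D (ComplexShape.down ℕ) n).map
        ((NatTrans.mapHomologicalComplex α _).app P) = 0 :=
  (ldSC_shortExact α β w hse P).δ_comp (n+1) n (by simp)

theorem ldd_exact (P : ChainComplex C ℕ) [∀ n, Projective (P.X n)] (n : ℕ) :
    (ShortComplex.mk _ _ (ldd_comp α β w hse P n)).Exact :=
  (ldSC_shortExact α β w hse P).homology_exact₁ (n+1) n (by simp)

theorem ldd_isIso (P : ChainComplex C ℕ) [∀ n, Projective (P.X n)] (n : ℕ)
    (h1 : IsZero ((HomologicalComplex.homologyFunctor D _ (n+1)).obj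
      ((G.mapHomologicalComplex _).obj P)))
    (h2 : IsZero ((HomologicalComplex.homologyFunctor D _ n).obj
      ((G.mapHomologicalComplex _).obj P))) : IsIso (ldd α β w hse P n) :=
  (ldSC_shortExact α β w hse P).isIso_δ (n+1) n (by simp) h1 h2

theorem ldd_mono (P : ChainComplex C ℕ) [∀ n, Projective (P.X n)] (n : ℕ)
    (h1 : IsZero ((HomologicalComplex.homologyFunctor D _ (n+1)).obj
      ((G.mapHomologicalComplex _).obj P))) : Mono (ldd α β w hse P n) :=
  (ldSC_shortExact α β w hse P).mono_δ (n+1) n (by simp) h1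

/-- The connecting natural transformation. -/
noncomputable def ldδ (n : ℕ) : H.leftDerived (n+1) ⟶ F.leftDerived n where
  app A := ((projectiveResolution A).isoLeftDerivedObj H (n+1)).hom ≫
    ldd α β w hse (projectiveResolution A).complex n ≫
    ((projectiveResolution A).isoLeftDerivedObj F n).inv
  naturality A B f := by
    let φ := ProjectiveResolution.lift f (projectiveResolution A) (projectiveResolution B)
    have comm : φ.f 0 ≫ (projectiveResolution B).π.f 0 = (projectiveResolution A).π.f 0 ≫ f := by
      exact ProjectiveResolution.lift_commutes_zero f _ _
    rw [← Category.assoc, ProjectiveResolution.isoLeftDerivedObj_hom_naturality f _ _ φ comm]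
    simp only [Category.assoc]
    rw [ProjectiveResolution.isoLeftDerivedObj_inv_naturality f _ _ φ comm]
    have := ldd_naturality α β w hse _ _ φ n
    rw [← Category.assoc ((H.mapHomologicalComplex _ ⋙ _).map φ), ← this, Category.assoc]

theorem ldδ_isIso (hz : ∀ n A, IsZero ((G.leftDerived (n+1)).obj A)) (n : ℕ) :
    IsIso (ldδ α β w hse (n+1)) := by
  have : ∀ A, IsIso ((ldδ α β w hse (n+1)).app A) := by
    intro A
    have := ldd_isIso α β w hse (projectiveResolution A).complex (n+1)
      ((hz (n+1) A).of_iso ((projectiveResolution A).isoLeftDerivedObj G (n+1+1)).symm)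
      ((hz n A).of_iso ((projectiveResolution A).isoLeftDerivedObj G (n+1)).symm)
    dsimp [ldδ]
    infer_instance
  exact NatIso.isIso_of_isIso_app _

theorem ldδ_comp_app (A : C) :
    (ldδ α β w hse 0).app A ≫ (NatTrans.leftDerived α 0).app A = 0 := by
  rw [ProjectiveResolution.leftDerived_app_eq α (projectiveResolution A)]
  have := ldd_comp α β w hse (projectiveResolution A).complex 0
  dsimp only [ldδ]
  simp only [Category.assoc, Iso.inv_hom_id_assoc]
  rw [reassoc_of% this]
  simp

theorem ldδ_exact (A : C) : (ShortComplex.mk ((ldδ α β w hse 0).app A)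
    ((NatTrans.leftDerived α 0).app A) (ldδ_comp_app α β w hse A)).Exact := by
  have := ldd_exact α β w hse (projectiveResolution A).complex 0
  refine (ShortComplex.exact_iff_of_iso (ShortComplex.isoMk
    ((projectiveResolution A).isoLeftDerivedObj H 1)
    ((projectiveResolution A).isoLeftDerivedObj F 0)
    ((projectiveResolution A).isoLeftDerivedObj G 0) ?_ ?_)).2 this
  · dsimp only [ldδ]; simp
  · dsimp only
    rw [ProjectiveResolution.leftDerived_app_eq α (projectiveResolution A)]
    simp only [Category.assoc, Iso.inv_hom_id, Category.comp_id]

theorem ldδ_mono (hz : ∀ n A, IsZero ((G.leftDerived (n+1)).obj A)) (A : C) :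
    Mono ((ldδ α β w hse 0).app A) := by
  have := ldd_mono α β w hse (projectiveResolution A).complex 0
      ((hz 0 A).of_iso ((projectiveResolution A).isoLeftDerivedObj G 1).symm)
  dsimp only [ldδ]
  infer_instance
end partone

section parttwo
variable {R : Type} [CommRing R]

theorem ext_isZero_of_injective (A I : ModuleCat.{0} R) [Injective I] (n : ℕ) :
    IsZero (((Ext R (ModuleCat.{0} R) (n+1)).obj (Opposite.op A)).obj I) := by
  refine IsZero.of_iso ?_ ((projectiveResolution A).isoExt (n + 1) I)
  rw [← HomologicalComplex.exactAt_iff_isZero_homology,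
    HomologicalComplex.exactAt_iff' _ n (n+1) (n+2) (by simp) (by simp)]
  rw [ShortComplex.moduleCat_exact_iff]
  intro x hx
  let x' : (projectiveResolution A).complex.X (n+1) ⟶ I := x
  have hx' : (projectiveResolution A).complex.d (n+2) (n+1) ≫ x' = 0 := hx
  have hex := (HomologicalComplex.exactAt_iff' _ (n+2) (n+1) n (by simp) (by simp)).1
    ((projectiveResolution A).complex_exactAt_succ n)
  refine ⟨hex.descToInjective x' hx', ?_⟩
  exact hex.comp_descToInjective x' hx'

/-- The contravariant functor `Hom(-, X)` with values in the opposite category. -/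
noncomputable abbrev hY (X : ModuleCat.{0} R) : ModuleCat.{0} R ⥤ (ModuleCat.{0} R)ᵒᵖ :=
  ((linearYoneda R (ModuleCat.{0} R)).obj X).rightOp

noncomputable abbrev hYmap {X Y : ModuleCat.{0} R} (f : X ⟶ Y) : hY Y ⟶ hY X :=
  NatTrans.rightOp ((linearYoneda R (ModuleCat.{0} R)).map f)

variable (S : ShortComplex (ModuleCat.{0} R)) (hS : S.ShortExact)

theorem hY_w : hYmap S.g ≫ hYmap S.f = 0 := by
  ext A
  apply Quiver.Hom.unop_inj
  ext (φ : A ⟶ S.X₁)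
  change (φ ≫ S.f) ≫ S.g = 0
  simp

include hS in
theorem hY_se (P : ModuleCat.{0} R) [Projective P] :
    (ShortComplex.mk ((hYmap S.g).app P) ((hYmap S.f).app P)
    (by rw [← NatTrans.comp_app, hY_w]; rfl)).ShortExact := by
  have hm := hS.mono_f
  have he := hS.epi_g
  let T : ShortComplex (ModuleCat.{0} R) :=
    ShortComplex.mk (((linearYoneda R (ModuleCat.{0} R)).map S.f).app (Opposite.op P))
      (((linearYoneda R (ModuleCat.{0} R)).map S.g).app (Opposite.op P)) (by
        ext (φ : P ⟶ S.X₁)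
        change (φ ≫ S.f) ≫ S.g = 0
        simp)
  have hT : T.ShortExact := by
    refine ShortComplex.ShortExact.mk' ?_ ?_ ?_
    · rw [ShortComplex.moduleCat_exact_iff]
      intro (φ : P ⟶ S.X₂) (hφ : φ ≫ S.g = 0)
      exact ⟨hS.exact.lift φ hφ, hS.exact.lift_f φ hφ⟩
    · rw [ModuleCat.mono_iff_injective]
      intro (φ : P ⟶ S.X₁) (ψ : P ⟶ S.X₁) (h : φ ≫ S.f = ψ ≫ S.f)
      exact (cancel_mono _).1 h
    · rw [ModuleCat.epi_iff_surjective]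
      intro (φ : P ⟶ S.X₃)
      exact ⟨Projective.factorThru φ S.g, Projective.factorThru_comp φ S.g⟩
  exact hT.op

/-- The connecting map on `Ext`, natural in the first variable. -/
noncomputable def extδ (n : ℕ) : (Ext R (ModuleCat.{0} R) n).flip.obj S.X₃ ⟶
    (Ext R (ModuleCat.{0} R) (n+1)).flip.obj S.X₁ :=
  NatTrans.leftOp (ldδ (hYmap S.g) (hYmap S.f) (hY_w S) (hY_se S hS) n)

theorem hY_zero [Injective S.X₂] (n : ℕ) (A : ModuleCat.{0} R) :
    IsZero (((hY S.X₂).leftDerived (n+1)).obj A) :=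
  (ext_isZero_of_injective A S.X₂ n).op

theorem extδ_isIso [Injective S.X₂] (n : ℕ) : IsIso (extδ S hS (n+1)) := by
  have := ldδ_isIso (hYmap S.g) (hYmap S.f) (hY_w S) (hY_se S hS) (hY_zero S) n
  have h2 : ∀ A, IsIso ((extδ S hS (n+1)).app A) := by
    intro A
    change IsIso ((ldδ (hYmap S.g) (hYmap S.f) (hY_w S) (hY_se S hS) (n+1)).app A.unop).unop
    infer_instance
  exact NatIso.isIso_of_isIso_app _

theorem extδ_epi [Injective S.X₂] (A) : Epi ((extδ S hS 0).app A) := by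
  have := ldδ_mono (hYmap S.g) (hYmap S.f) (hY_w S) (hY_se S hS) (hY_zero S) A.unop
  change Epi ((ldδ (hYmap S.g) (hYmap S.f) (hY_w S) (hY_se S hS) 0).app A.unop).unop
  infer_instance

theorem extδ_comp_app (A) : ((Ext R (ModuleCat.{0} R) 0).flip.map S.g).app A ≫
    (extδ S hS 0).app A = 0 := 
  congrArg Quiver.Hom.unop
    (ldδ_comp_app (hYmap S.g) (hYmap S.f) (hY_w S) (hY_se S hS) A.unop)

theorem extδ_exact (A) : (ShortComplex.mk _ _ (extδ_comp_app S hS A)).Exact := 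
  (ldδ_exact (hYmap S.g) (hYmap S.f) (hY_w S) (hY_se S hS) A.unop).unop

end parttwo

section partthree

theorem fromLeftDerivedZero_nat {C D : Type*} [Category* C] [Category* D] [Abelian C] [Abelian D]
    [EnoughProjectives C] {F G : C ⥤ D} [F.Additive] [G.Additive] (α : F ⟶ G) (A : C) :
    (NatTrans.leftDerived α 0).app A ≫ G.fromLeftDerivedZero.app A =
      F.fromLeftDerivedZero.app A ≫ α.app A := by
  rw [ProjectiveResolution.leftDerived_app_eq α (projectiveResolution A),
    (projectiveResolution A).fromLeftDerivedZero_eq G,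
    (projectiveResolution A).fromLeftDerivedZero_eq F]
  simp only [Category.assoc, Iso.inv_hom_id_assoc]
  congr 1
  have h : HomologicalComplex.opcyclesMap
      ((NatTrans.mapHomologicalComplex α (ComplexShape.down ℕ)).app
        (projectiveResolution A).complex) 0 ≫ (projectiveResolution A).fromLeftDerivedZero' G =
      (projectiveResolution A).fromLeftDerivedZero' F ≫ α.app A := by
    simp only [← cancel_epi (HomologicalComplex.pOpcycles _ _),
      HomologicalComplex.p_opcyclesMap_assoc]
    rw [ProjectiveResolution.pOpcycles_comp_fromLeftDerivedZero',
      reassoc_of% ProjectiveResolution.pOpcycles_comp_fromLeftDerivedZero']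
    exact (α.naturality _).symm
  have h2 := HomologicalComplex.homologyι_naturality
    ((NatTrans.mapHomologicalComplex α (ComplexShape.down ℕ)).app
        (projectiveResolution A).complex) 0
  have h3 := congrArg (fun t => t ≫ (projectiveResolution A).fromLeftDerivedZero' G) h2
  simp only [Category.assoc, h] at h3
  refine Eq.trans ?_ (h3.trans ?_)
  · rfl
  · exact (Category.assoc _ _ _).symm

variable {R : Type} [CommRing R]

instance hY_pres (X : ModuleCat.{0} R) : PreservesFiniteColimits (hY X) := by
  have h1 : PreservesFiniteLimits ((linearYoneda R (ModuleCat.{0} R)).obj X ⋙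
      forget (ModuleCat.{0} R)) := by
    change PreservesFiniteLimits (yoneda.obj X)
    infer_instance
  have : PreservesFiniteLimits ((linearYoneda R (ModuleCat.{0} R)).obj X) :=
    preservesFiniteLimits_of_reflects_of_preserves _ (forget (ModuleCat.{0} R))
  exact preservesFiniteColimits_rightOp _

/-- `Hom(-,X) ⟶ Ext^0(-,X)`. -/
noncomputable def homExt (X : ModuleCat.{0} R) : (linearYoneda R (ModuleCat.{0} R)).obj X ⟶
    (Ext R (ModuleCat.{0} R) 0).flip.obj X :=
  NatTrans.leftOp (hY X).fromLeftDerivedZero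

instance homExt_isIso (X : ModuleCat.{0} R) (A) : IsIso ((homExt X).app A) := by
  change IsIso ((hY X).fromLeftDerivedZero.app A.unop).unop
  infer_instance

theorem homExt_nat {X Y : ModuleCat.{0} R} (f : X ⟶ Y) (A) :
    (homExt X).app A ≫ ((Ext R (ModuleCat.{0} R) 0).flip.map f).app A =
    ((linearYoneda R (ModuleCat.{0} R)).map f).app A ≫ (homExt Y).app A := 
  congrArg Quiver.Hom.unop (fromLeftDerivedZero_nat (hYmap f) A.unop)

end partthree

section partfour
open Opposite
variable {R : Type} [CommRing R]

theorem colimMap_ι_apply {J : Type} [SmallCategory J] {F G : J ⥤ ModuleCat.{0} R} (a : F ⟶ G)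
    (j : J) (x : F.obj j) : colimMap a (colimit.ι F j x) = colimit.ι G j (a.app j x) := by
  have := ι_colimMap a j
  exact congrArg (fun t => t.hom x) this

theorem colimMap_surj {J : Type} [SmallCategory J] {F G : J ⥤ ModuleCat.{0} R} [IsFiltered J]
    (b : F ⟶ G)
    (hb : ∀ j, Function.Surjective (b.app j)) : Function.Surjective (colimMap b) := by
  intro y
  obtain ⟨j, y, rfl⟩ := Concrete.colimit_exists_rep G y
  obtain ⟨x, rfl⟩ := hb j y
  exact ⟨colimit.ι F j x, colimMap_ι_apply b j x⟩

theorem colimMap_exact {J : Type} [SmallCategory J] {F G K : J ⥤ ModuleCat.{0} R} [IsFiltered J]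
    (a : F ⟶ G) (b : G ⟶ K)
    (h : ∀ j, ∀ y, b.app j y = 0 ↔ ∃ x, a.app j x = y) (y : (colimit G : ModuleCat.{0} R)) :
    colimMap b y = 0 ↔ ∃ x, colimMap a x = y := by
  constructor
  · obtain ⟨j, y, rfl⟩ := Concrete.colimit_exists_rep G y
    intro hy
    rw [colimMap_ι_apply] at hy
    have hy' : colimit.ι K j (b.app j y) = colimit.ι K j 0 := by rw [hy]; simp
    obtain ⟨k, f, g, hfg⟩ := Concrete.colimit_exists_of_rep_eq K _ _ hy'
    have h0 : b.app k (G.map f y) = 0 := by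
      have := congrArg (fun t => t.hom y) (b.naturality f)
      refine Eq.trans this ?_
      refine Eq.trans hfg ?_
      simp
    obtain ⟨x, hx⟩ := (h k _).1 h0
    refine ⟨colimit.ι F k x, ?_⟩
    rw [colimMap_ι_apply, hx]
    exact congrArg (fun t => t.hom y) (colimit.w G f)
  · rintro ⟨x, rfl⟩
    obtain ⟨j, x, rfl⟩ := Concrete.colimit_exists_rep F x
    rw [colimMap_ι_apply, colimMap_ι_apply, (h j _).2 ⟨x, rfl⟩]
    simp

/-- The diagram computing local cohomology of `X`. -/
noncomputable abbrev Ed (J : Ideal R) (i : ℕ) (X : ModuleCat.{0} R) :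
    ℕᵒᵖᵒᵖ ⥤ ModuleCat.{0} R :=
  (localCohomology.ringModIdeals (localCohomology.idealPowersDiagram J)).op ⋙
    (Ext R (ModuleCat.{0} R) i).flip.obj X

noncomputable abbrev Hm (J : Ideal R) (X : ModuleCat.{0} R) :
    ℕᵒᵖᵒᵖ ⥤ ModuleCat.{0} R :=
  (localCohomology.ringModIdeals (localCohomology.idealPowersDiagram J)).op ⋙
    (linearYoneda R (ModuleCat.{0} R)).obj X

noncomputable def lcIso (J : Ideal R) (i : ℕ) (X : ModuleCat.{0} R) :
    (localCohomology J i).obj X ≅ colimit (Ed J i X) :=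
  colimitObjIsoColimitCompEvaluation
    (localCohomology.diagram (localCohomology.idealPowersDiagram J) i) X

noncomputable def hmIso (J : Ideal R) (X : ModuleCat.{0} R) : Hm J X ≅ Ed J 0 X :=
  NatIso.ofComponents (fun A => asIso ((homExt X).app _))
    (fun f => (homExt X).naturality _)

/-- `J`-power torsion. -/
def gam (J : Ideal R) (X : Type) [AddCommGroup X] [Module R X] : Submodule R X where
  carrier := {x | ∃ t, ∀ r ∈ J ^ t, r • x = 0}
  zero_mem' := ⟨0, by simp⟩
  add_mem' := by
    rintro x y ⟨t, ht⟩ ⟨s, hs⟩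
    refine ⟨t + s, fun r hr => ?_⟩
    rw [smul_add, ht r (Ideal.pow_le_pow_right (by omega) hr),
      hs r (Ideal.pow_le_pow_right (by omega) hr), add_zero]
  smul_mem' := by
    rintro c x ⟨t, ht⟩
    refine ⟨t, fun r hr => ?_⟩
    rw [smul_comm, ht r hr, smul_zero]

theorem mem_gam {J : Ideal R} {X : Type} [AddCommGroup X] [Module R X] {x : X} :
    x ∈ gam J X ↔ ∃ t, ∀ r ∈ J ^ t, r • x = 0 := Iff.rfl

/-- Evaluation at one. -/
noncomputable def ev1 (J : Ideal R) (X : ModuleCat.{0} R) (t : ℕᵒᵖᵒᵖ) :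
    (Hm J X).obj t →ₗ[R] X where
  toFun φ := (ModuleCat.Hom.hom (φ : ModuleCat.of R (R ⧸ J ^ t.unop.unop) ⟶ X))
    (Ideal.Quotient.mk _ 1)
  map_add' _ _ := rfl
  map_smul' _ _ := rfl

noncomputable def evc (J : Ideal R) (X : ModuleCat.{0} R) : Cocone (Hm J X) where
  pt := X
  ι := { app := fun t => ModuleCat.ofHom (ev1 J X t)
         naturality := fun _ _ _ => rfl }

noncomputable def evd (J : Ideal R) (X : ModuleCat.{0} R) :
    colimit (Hm J X) ⟶ X := colimit.desc (Hm J X) (evc J X)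

theorem evd_ι (J : Ideal R) (X : ModuleCat.{0} R) (t) (φ : (Hm J X).obj t) :
    evd J X (colimit.ι (Hm J X) t φ) = ev1 J X t φ :=
  congrArg (fun u => u.hom φ) (colimit.ι_desc (evc J X) t)

theorem ev1_inj (J : Ideal R) (X : ModuleCat.{0} R) (t) : Function.Injective (ev1 J X t) := by
  intro φ ψ h
  apply ModuleCat.hom_ext
  apply Submodule.linearMap_qext
  apply LinearMap.ext_ring
  exact h

theorem ev1_mem (J : Ideal R) (X : ModuleCat.{0} R) (t) (φ : (Hm J X).obj t) :
    ∀ r ∈ J ^ t.unop.unop, r • ev1 J X t φ = 0 := by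
  intro r hr
  let φ' : (R ⧸ J ^ t.unop.unop) →ₗ[R] X :=
    (ModuleCat.Hom.hom (φ : ModuleCat.of R (R ⧸ J ^ t.unop.unop) ⟶ X))
  change r • φ' (Ideal.Quotient.mk _ 1) = 0
  rw [← map_smul]
  have : r • (Ideal.Quotient.mk (J ^ t.unop.unop) 1) = 0 := by
    change Ideal.Quotient.mk (J ^ t.unop.unop) (r * 1) = 0
    rw [mul_one]
    exact Ideal.Quotient.eq_zero_iff_mem.2 hr
  rw [this, map_zero]

theorem evd_inj (J : Ideal R) (X : ModuleCat.{0} R) : Function.Injective (evd J X) := by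
  rw [injective_iff_map_eq_zero]
  intro y hy
  obtain ⟨j, y, rfl⟩ := Concrete.colimit_exists_rep (Hm J X) y
  rw [evd_ι] at hy
  have : y = 0 := ev1_inj J X j (hy.trans (map_zero _).symm)
  rw [this]; simp

theorem evd_range (J : Ideal R) (X : ModuleCat.{0} R) (x : X) :
    (∃ z, evd J X z = x) ↔ x ∈ gam J X := by
  constructor
  · rintro ⟨z, rfl⟩
    obtain ⟨j, y, rfl⟩ := Concrete.colimit_exists_rep (Hm J X) z
    rw [evd_ι]
    exact ⟨_, ev1_mem J X j y⟩
  · rintro ⟨t, ht⟩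
    have hle : J ^ t ≤ LinearMap.ker (LinearMap.toSpanSingleton R X x) := by
      intro r hr
      rw [LinearMap.mem_ker, LinearMap.toSpanSingleton_apply]
      exact ht r hr
    let φ : ModuleCat.of R (R ⧸ J ^ t) ⟶ X := ModuleCat.ofHom
      (Submodule.liftQ (J ^ t) (LinearMap.toSpanSingleton R X x) hle)
    let φ' : (Hm J X).obj (op (op t)) := φ
    refine ⟨colimit.ι (Hm J X) (op (op t)) φ', ?_⟩
    rw [evd_ι]
    change Submodule.liftQ (J ^ t) (LinearMap.toSpanSingleton R X x) hle (Submodule.Quotient.mk 1) = x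
    rw [Submodule.liftQ_apply, LinearMap.toSpanSingleton_apply, one_smul]

noncomputable def evE (J : Ideal R) (X : ModuleCat.{0} R) :
    (colimit (Hm J X) : ModuleCat.{0} R) ≃ₗ[R] gam J X :=
  LinearEquiv.ofBijective ((evd J X).hom.codRestrict (gam J X)
    (fun z => (evd_range J X _).1 ⟨z, rfl⟩)) ⟨fun a b h => evd_inj J X (congrArg Subtype.val h),
      fun x => by
        obtain ⟨z, hz⟩ := (evd_range J X x).2 x.2
        exact ⟨z, Subtype.ext hz⟩⟩

theorem evE_nat (J : Ideal R) {X Y : ModuleCat.{0} R} (f : X ⟶ Y)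
    (z : (colimit (Hm J X) : ModuleCat.{0} R)) :
    (evE J Y (colimMap (Functor.whiskerLeft
      (localCohomology.ringModIdeals (localCohomology.idealPowersDiagram J)).op
      ((linearYoneda R (ModuleCat.{0} R)).map f)) z) : Y) = f (evE J X z : X) := by
  obtain ⟨j, y, rfl⟩ := Concrete.colimit_exists_rep (Hm J X) z
  rw [colimMap_ι_apply]
  change evd J Y _ = f (evd J X _)
  rw [evd_ι, evd_ι]
  rfl

theorem lcZ (J : Ideal R) (X : ModuleCat.{0} R) :
    Nonempty ((localCohomology J 0).obj X ≃ₗ[R] gam J X) :=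
  ⟨((lcIso J 0 X).trans (HasColimit.isoOfNatIso (hmIso J X)).symm).toLinearEquiv.trans (evE J X)⟩

theorem lcS2 (J : Ideal R) (S : ShortComplex (ModuleCat.{0} R)) (hS : S.ShortExact)
    [Injective S.X₂] (i : ℕ) :
    Nonempty ((localCohomology J (i+2)).obj S.X₁ ≅ (localCohomology J (i+1)).obj S.X₃) := by
  have := extδ_isIso S hS i
  exact ⟨lcIso J (i+2) S.X₁ ≪≫ (HasColimit.isoOfNatIso
    (Functor.isoWhiskerLeft _ (asIso (extδ S hS (i+1))))).symm ≪≫ (lcIso J (i+1) S.X₃).symm⟩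

theorem homExt_w (S : ShortComplex (ModuleCat.{0} R)) (hS : S.ShortExact) (A) :
    ((linearYoneda R (ModuleCat.{0} R)).map S.g).app A ≫
      (homExt S.X₃ ≫ extδ S hS 0).app A = 0 := by
  rw [NatTrans.comp_app, ← Category.assoc, ← homExt_nat, Category.assoc, extδ_comp_app, comp_zero]

theorem homExt_exact (S : ShortComplex (ModuleCat.{0} R)) (hS : S.ShortExact) (A)
    (y : ((linearYoneda R (ModuleCat.{0} R)).obj S.X₃).obj A) :
    (homExt S.X₃ ≫ extδ S hS 0).app A y = 0 ↔
      ∃ x, ((linearYoneda R (ModuleCat.{0} R)).map S.g).app A x = y := by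
  have w := homExt_w S hS A
  have h2 : (ShortComplex.mk _ _ w).Exact := by
    let i1 : (ShortComplex.mk _ _ w) ≅ (ShortComplex.mk _ _ (extδ_comp_app S hS A)) :=
      ShortComplex.isoMk
        (asIso ((homExt S.X₂).app A) :
          ((linearYoneda R (ModuleCat.{0} R)).obj S.X₂).obj A ≅ _)
        (asIso ((homExt S.X₃).app A) :
          ((linearYoneda R (ModuleCat.{0} R)).obj S.X₃).obj A ≅ _)
        (Iso.refl _) (homExt_nat S.g A) (Category.comp_id _).symm
    exact (ShortComplex.exact_iff_of_iso i1).2 (extδ_exact S hS A)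
  constructor
  · exact (ShortComplex.moduleCat_exact_iff _).1 h2 y
  · rintro ⟨x, rfl⟩
    exact congrArg (fun t => t.hom x) w

theorem lcS1 (J : Ideal R) (S : ShortComplex (ModuleCat.{0} R)) (hS : S.ShortExact)
    [Injective S.X₂] :
    ∃ q : gam J S.X₃ →ₗ[R] (localCohomology J 1).obj S.X₁, Function.Surjective q ∧
      ∀ y, q y = 0 ↔ ∃ x ∈ gam J S.X₂, S.g x = y := by
  let D := (localCohomology.ringModIdeals (localCohomology.idealPowersDiagram J)).op
  let a : Hm J S.X₂ ⟶ Hm J S.X₃ :=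
    Functor.whiskerLeft D ((linearYoneda R (ModuleCat.{0} R)).map S.g)
  let b : Hm J S.X₃ ⟶ Ed J 1 S.X₁ := Functor.whiskerLeft D (homExt S.X₃ ≫ extδ S hS 0)
  have hb : ∀ j, Function.Surjective (b.app j) := by
    intro j
    have := extδ_epi S hS (D.obj j)
    rw [← ModuleCat.epi_iff_surjective]
    change Epi ((homExt S.X₃).app (D.obj j) ≫ (extδ S hS 0).app (D.obj j))
    infer_instance
  have hab : ∀ j, ∀ y, b.app j y = 0 ↔ ∃ x, a.app j x = y := by
    intro j y
    exact homExt_exact S hS (D.obj j) y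
  let e := evE J S.X₃
  let q : gam J S.X₃ →ₗ[R] (localCohomology J 1).obj S.X₁ :=
    (lcIso J 1 S.X₁).symm.toLinearEquiv.toLinearMap ∘ₗ (colimMap b).hom ∘ₗ e.symm.toLinearMap
  refine ⟨q, ?_, ?_⟩
  · exact (lcIso J 1 S.X₁).symm.toLinearEquiv.surjective.comp
      ((colimMap_surj b hb).comp e.symm.surjective)
  · intro y
    have h3 : q y = 0 ↔ colimMap b (e.symm y) = 0 :=
      (lcIso J 1 S.X₁).symm.toLinearEquiv.map_eq_zero_iff
    rw [h3, colimMap_exact a b hab]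
    constructor
    · rintro ⟨x, hx⟩
      refine ⟨evE J S.X₂ x, (evE J S.X₂ x).2, ?_⟩
      rw [← evE_nat]
      change ((e (colimMap a x) : gam J S.X₃) : S.X₃) = y
      rw [hx]; simp
    · rintro ⟨x, hx, hxy⟩
      refine ⟨(evE J S.X₂).symm ⟨x, hx⟩, ?_⟩
      apply e.injective
      apply Subtype.ext
      refine (evE_nat J S.g _).trans ?_
      simpa using hxy

theorem lcBotSucc (X : ModuleCat.{0} R) (i : ℕ) :
    Subsingleton ((localCohomology (⊥ : Ideal R) (i+1)).obj X) := by
  refine (lcIso (⊥ : Ideal R) (i+1) X).toLinearEquiv.toEquiv.subsingleton_congr.2 ?_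
  refine ⟨fun a b => ?_⟩
  suffices h : ∀ a : (colimit (Ed (⊥ : Ideal R) (i+1) X) : ModuleCat.{0} R), a = 0 by
    rw [h a, h b]
  intro a
  obtain ⟨j, y, rfl⟩ := Concrete.colimit_exists_rep _ a
  have hp : Projective ((localCohomology.ringModIdeals
      (localCohomology.idealPowersDiagram (⊥ : Ideal R))).obj j.unop) := by
    change Projective (ModuleCat.of R (R ⧸ (⊥ : Ideal R) ^ j.unop.unop))
    rcases h : j.unop.unop with _ | n
    · rw [pow_zero, Ideal.one_eq_top]
      infer_instance
    · have : (⊥ : Ideal R) ^ (n+1) = ⊥ := by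
        rw [← Ideal.zero_eq_bot, zero_pow (by omega)]
      rw [this]
      have : Module.Projective R (R ⧸ (⊥ : Ideal R)) :=
        Module.Projective.of_equiv (Submodule.quotEquivOfEqBot (⊥ : Ideal R) rfl).symm
      infer_instance
  have := isZero_Ext_succ_of_projective (R := R) ((localCohomology.ringModIdeals
      (localCohomology.idealPowersDiagram (⊥ : Ideal R))).obj j.unop) X i
  have h0 : Subsingleton ((Ed (⊥ : Ideal R) (i+1) X).obj j) :=
    ModuleCat.subsingleton_of_isZero this
  rw [Subsingleton.elim y 0, map_zero]

theorem gam_bot (X : Type) [AddCommGroup X] [Module R X] : gam (⊥ : Ideal R) X = ⊤ := by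
  rw [eq_top_iff]
  intro x _
  refine ⟨1, fun r hr => ?_⟩
  rw [pow_one, Ideal.mem_bot] at hr
  rw [hr, zero_smul]

end partfour

section partfive
variable {R : Type} [CommRing R]

/-- Divisibility by `f` up to `f`-torsion. -/
def fdiv (f : R) (M : Type) [AddCommGroup M] [Module R M] : Prop :=
  ∀ x : M, ∃ (m : ℕ) (y : M), f ^ (m + 1) • y = f ^ m • x

theorem fdiv_of_surj {f : R} {M N : Type} [AddCommGroup M] [Module R M] [AddCommGroup N]
    [Module R N] (g : M →ₗ[R] N) (hg : Function.Surjective g) (h : fdiv f M) : fdiv f N := by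
  intro x
  obtain ⟨x, rfl⟩ := hg x
  obtain ⟨m, y, hy⟩ := h x
  exact ⟨m, g y, by rw [← map_smul, hy, map_smul]⟩

theorem fdiv_pow {f : R} {M : Type} [AddCommGroup M] [Module R M] (h : fdiv f M) (k : ℕ) :
    ∀ x : M, ∃ (m : ℕ) (y : M), f ^ (m + k) • y = f ^ m • x := by
  induction k with
  | zero => exact fun x => ⟨0, x, rfl⟩
  | succ k ih =>
    intro x
    obtain ⟨m, y, hy⟩ := h x
    obtain ⟨n, z, hz⟩ := ih y
    refine ⟨m + n, z, ?_⟩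
    calc f ^ (m + n + (k + 1)) • z = f ^ (m + 1) • (f ^ (n + k) • z) := by
          rw [smul_smul]; ring_nf
      _ = f ^ n • (f ^ (m + 1) • y) := by rw [hz, smul_smul, smul_smul]; ring_nf
      _ = _ := by rw [hy, smul_smul]; ring_nf

abbrev Lf (f : R) (M : Type) [AddCommGroup M] [Module R M] : Type :=
  LocalizedModule (Submonoid.powers f) M

noncomputable abbrev mkL (f : R) (M : Type) [AddCommGroup M] [Module R M] : M →ₗ[R] Lf f M :=
  LocalizedModule.mkLinearMap (Submonoid.powers f) M

/-- The cokernel of `M → M_f`. -/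
abbrev Cf (f : R) (M : Type) [AddCommGroup M] [Module R M] : Type :=
  Lf f M ⧸ LinearMap.range (mkL f M)

theorem mkL_eq_zero (f : R) {M : Type} [AddCommGroup M] [Module R M] (x : M) :
    mkL f M x = 0 ↔ ∃ n : ℕ, f ^ n • x = 0 := by
  rw [IsLocalizedModule.eq_zero_iff (Submonoid.powers f)]
  constructor
  · rintro ⟨⟨_, n, rfl⟩, h⟩
    exact ⟨n, h⟩
  · rintro ⟨n, h⟩
    exact ⟨⟨_, n, rfl⟩, h⟩

theorem mkL_surj {f : R} {M : Type} [AddCommGroup M] [Module R M] (h : fdiv f M) :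
    Function.Surjective (mkL f M) := by
  intro z
  induction z using LocalizedModule.induction_on with
  | _ x s =>
    obtain ⟨_, k, rfl⟩ := s
    obtain ⟨m, y, hy⟩ := fdiv_pow h k x
    refine ⟨y, ?_⟩
    rw [LocalizedModule.mkLinearMap_apply, LocalizedModule.mk_eq]
    refine ⟨⟨_, m, rfl⟩, ?_⟩
    change f ^ m • f ^ k • y = f ^ m • (1 : R) • x
    rw [one_smul, ← hy, smul_smul, pow_add]

theorem Cf_subsingleton {f : R} {M : Type} [AddCommGroup M] [Module R M] (h : fdiv f M) :
    Subsingleton (Cf f M) := by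
  rw [Submodule.Quotient.subsingleton_iff, LinearMap.range_eq_top]
  exact mkL_surj h

noncomputable abbrev mapL (f : R) {M N : Type} [AddCommGroup M] [Module R M] [AddCommGroup N]
    [Module R N] (g : M →ₗ[R] N) : Lf f M →ₗ[R] Lf f N :=
  IsLocalizedModule.map (Submonoid.powers f) (mkL f M) (mkL f N) g

theorem mapL_mkL (f : R) {M N : Type} [AddCommGroup M] [Module R M] [AddCommGroup N]
    [Module R N] (g : M →ₗ[R] N) (x : M) : mapL f g (mkL f M x) = mkL f N (g x) :=
  IsLocalizedModule.map_apply _ _ _ _ _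

theorem mapL_exact (f : R) {A M N : Type} [AddCommGroup A] [Module R A] [AddCommGroup M]
    [Module R M] [AddCommGroup N] [Module R N] (h : A →ₗ[R] M) (g : M →ₗ[R] N)
    (e : Function.Exact h g) : Function.Exact (mapL f h) (mapL f g) :=
  IsLocalizedModule.map_exact _ _ _ _ _ _ e

theorem iso_of_ker {M A B : Type} [AddCommGroup A] [Module R A] [AddCommGroup M]
    [Module R M] [AddCommGroup B] [Module R B] (p : M →ₗ[R] A) (q : M →ₗ[R] B)
    (hp : Function.Surjective p) (hq : Function.Surjective q) (h : ∀ y, p y = 0 ↔ q y = 0) :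
    Nonempty (A ≃ₗ[R] B) := by
  have : LinearMap.ker p = LinearMap.ker q := by
    ext y; exact h y
  exact ⟨(p.quotKerEquivOfSurjective hp).symm.trans ((Submodule.quotEquivOfEq _ _ this).trans
    (q.quotKerEquivOfSurjective hq))⟩

theorem Cf_iso_of_exact (f : R) {A M N : Type} [AddCommGroup A] [Module R A] [AddCommGroup M]
    [Module R M] [AddCommGroup N] [Module R N] (h : A →ₗ[R] M) (g : M →ₗ[R] N)
    (e : Function.Exact h g) (hg : Function.Surjective g) (hA : fdiv f A) :
    Nonempty (Cf f M ≃ₗ[R] Cf f N) := by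
  refine iso_of_ker (M := Lf f M) (Submodule.mkQ _)
    ((LinearMap.range (mkL f N)).mkQ ∘ₗ mapL f g) (Submodule.mkQ_surjective _)
    ((Submodule.mkQ_surjective _).comp (IsLocalizedModule.map_surjective _ _ _ _ hg)) ?_
  intro y
  rw [LinearMap.comp_apply, Submodule.mkQ_apply, Submodule.mkQ_apply,
    Submodule.Quotient.mk_eq_zero, Submodule.Quotient.mk_eq_zero]
  constructor
  · rintro ⟨x, rfl⟩
    exact ⟨g x, (mapL_mkL f g x).symm⟩
  · rintro ⟨n, hn⟩
    obtain ⟨m, rfl⟩ := hg n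
    have h0 : mapL f g (y - mkL f M m) = 0 := by
      rw [map_sub, mapL_mkL, hn, sub_self]
    obtain ⟨a, ha⟩ := (mapL_exact f h g e _).1 h0
    obtain ⟨a, rfl⟩ := mkL_surj hA a
    refine ⟨h a + m, ?_⟩
    rw [map_add, ← mapL_mkL, ha, sub_add_cancel]

theorem Cf_congr (f : R) {M N : Type} [AddCommGroup M]
    [Module R M] [AddCommGroup N] [Module R N] (g : M ≃ₗ[R] N) :
    Nonempty (Cf f M ≃ₗ[R] Cf f N) := by
  refine Cf_iso_of_exact f (A := PUnit) 0 g.toLinearMap ?_ g.surjective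
    (fun x => ⟨0, x, rfl⟩)
  intro y
  constructor
  · intro hy
    have : y = 0 := g.map_eq_zero_iff.1 hy
    exact ⟨0, this.symm⟩
  · rintro ⟨x, rfl⟩
    simp

theorem snakeCf (f : R) {A M N : Type} [AddCommGroup A] [Module R A] [AddCommGroup M]
    [Module R M] [AddCommGroup N] [Module R N] (h : A →ₗ[R] M) (g : M →ₗ[R] N)
    (e : Function.Exact h g) (hh : Function.Injective h) (hg : Function.Surjective g)
    (hM : fdiv f M) : ∃ q : LinearMap.ker (mkL f N) →ₗ[R] Cf f A, Function.Surjective q ∧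
      ∀ y, q y = 0 ↔ ∃ x : M, mkL f M x = 0 ∧ g x = y := by
  have h1 : (mapL f h).comp (mkL f A) = (mkL f M).comp h := LinearMap.ext (mapL_mkL f h)
  have h2 : (mapL f g).comp (mkL f M) = (mkL f N).comp g := LinearMap.ext (mapL_mkL f g)
  have hi : Function.Injective (mapL f h) := IsLocalizedModule.map_injective _ _ _ _ hh
  have e3 : Function.Exact (LinearMap.ker (mkL f N)).subtype (mkL f N) :=
    LinearMap.exact_subtype_ker_map _
  have e2 : Function.Exact (LinearMap.ker (mkL f M)).subtype (mkL f M) :=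
    LinearMap.exact_subtype_ker_map _
  have c1 : Function.Exact (mkL f A) (LinearMap.range (mkL f A)).mkQ :=
    LinearMap.exact_map_mkQ_range _
  have c2 : Function.Exact (mkL f M) (0 : Lf f M →ₗ[R] PUnit.{1}) := by
    intro y
    exact ⟨fun _ => mkL_surj hM y, fun _ => rfl⟩
  let δ := SnakeLemma.δ' (mkL f A) (mkL f M) (mkL f N) h g e (mapL f h) (mapL f g)
    (mapL_exact f h g e) h1 h2 (LinearMap.ker (mkL f N)).subtype e3
    (LinearMap.range (mkL f A)).mkQ c1 hg hi
  refine ⟨δ, ?_, ?_⟩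
  · have := SnakeLemma.exact_δ'_left (mkL f A) (mkL f M) (mkL f N) h g e (mapL f h) (mapL f g)
      (mapL_exact f h g e) h1 h2 (LinearMap.ker (mkL f N)).subtype e3
      (LinearMap.range (mkL f A)).mkQ c1 (0 : Lf f M →ₗ[R] PUnit.{1}) c2 hg hi
      (0 : Cf f A →ₗ[R] PUnit.{1}) (by ext) (Submodule.mkQ_surjective _)
    intro y
    exact (this y).1 rfl
  · let F : LinearMap.ker (mkL f M) →ₗ[R] LinearMap.ker (mkL f N) :=
      g.restrict (fun x hx => by
        rw [LinearMap.mem_ker] at hx ⊢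
        rw [← mapL_mkL, hx, map_zero])
    have := SnakeLemma.exact_δ'_right (mkL f A) (mkL f M) (mkL f N) h g e (mapL f h) (mapL f g)
      (mapL_exact f h g e) h1 h2 (LinearMap.ker (mkL f M)).subtype e2
      (LinearMap.ker (mkL f N)).subtype e3
      (LinearMap.range (mkL f A)).mkQ c1 hg hi F rfl (Submodule.subtype_injective _)
    intro y
    rw [this y]
    constructor
    · rintro ⟨x, rfl⟩
      exact ⟨x.1, x.2, rfl⟩
    · rintro ⟨x, hx, hxy⟩
      exact ⟨⟨x, hx⟩, Subtype.ext hxy⟩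

theorem fdiv_gam_injective [IsNoetherianRing R] (b : Ideal R) (f : R) (I : ModuleCat.{0} R)
    [Injective I] : fdiv f (gam b I) := by
  rintro ⟨x, k, hk⟩
  let μ : ℕ → R →ₗ[R] (R ⧸ b ^ k) := fun m => (b ^ k).mkQ ∘ₗ LinearMap.mulLeft R (f ^ m)
  have hμ : ∀ m r, μ m r = 0 ↔ f ^ m * r ∈ b ^ k := fun m r => by
    change Submodule.Quotient.mk (f ^ m * r) = 0 ↔ _
    rw [Submodule.Quotient.mk_eq_zero]
  let K : ℕ →o Ideal R := ⟨fun m => LinearMap.ker (μ m), monotone_nat_of_le_succ (by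
    intro m r hr
    rw [LinearMap.mem_ker, hμ] at hr ⊢
    rw [pow_succ', mul_assoc]
    exact Ideal.mul_mem_left _ _ hr)⟩
  obtain ⟨m, hm⟩ := monotone_stabilizes_iff_noetherian.2 (inferInstance : IsNoetherian R R) K
  have hKm : K (m + 1) = K m := (hm (m+1) (by omega)).symm
  let u : (R ⧸ LinearMap.ker (μ (m+1))) →ₗ[R] (R ⧸ b ^ k) :=
    Submodule.liftQ _ (μ (m+1)) le_rfl
  have hu : Function.Injective u :=
    LinearMap.ker_eq_bot.1 (Submodule.ker_liftQ_eq_bot _ _ _ le_rfl)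
  have hle : LinearMap.ker (μ (m+1)) ≤ LinearMap.ker (LinearMap.toSpanSingleton R I (f ^ m • x)) := by
    intro r hr
    have hr' : r ∈ K m := hKm ▸ hr
    have hr2 := (hμ m r).1 hr'
    rw [LinearMap.mem_ker, LinearMap.toSpanSingleton_apply, smul_smul, mul_comm]
    exact hk _ hr2
  let v : (R ⧸ LinearMap.ker (μ (m+1))) →ₗ[R] I :=
    Submodule.liftQ _ (LinearMap.toSpanSingleton R I (f ^ m • x)) hle
  have : Mono (ModuleCat.ofHom u) := (ModuleCat.mono_iff_injective _).2 hu
  let w := Injective.factorThru (ModuleCat.ofHom v) (ModuleCat.ofHom u)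
  have hw : ModuleCat.ofHom u ≫ w = ModuleCat.ofHom v := Injective.comp_factorThru _ _
  let w' : (R ⧸ b ^ k) →ₗ[R] I := w.hom
  have hw' : ∀ z, w' (u z) = v z := fun z => congrArg (fun t => t.hom z) hw
  let one : R ⧸ b ^ k := Submodule.Quotient.mk 1
  have hone : ∀ r ∈ b ^ k, r • one = 0 := by
    intro r hr
    change Submodule.Quotient.mk (r • (1:R)) = 0
    rw [Submodule.Quotient.mk_eq_zero, smul_eq_mul, mul_one]
    exact hr
  refine ⟨m, ⟨w' one, k, fun r hr => ?_⟩, ?_⟩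
  · rw [← map_smul, hone r hr, map_zero]
  · apply Subtype.ext
    change f ^ (m+1) • w' one = f ^ m • x
    have h1 : u (Submodule.Quotient.mk 1) = f ^ (m+1) • one := by
      change (Submodule.Quotient.mk (f ^ (m+1) * 1) : R ⧸ b ^ k) =
        Submodule.Quotient.mk (f ^ (m+1) • 1)
      rw [smul_eq_mul]
    have h2 : v (Submodule.Quotient.mk 1) = f ^ m • x := by
      change LinearMap.toSpanSingleton R I (f ^ m • x) 1 = _
      rw [LinearMap.toSpanSingleton_apply, one_smul]
    rw [← map_smul, ← h1, hw', h2]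

theorem mem_gam_sup (b : Ideal R) (f : R) {X : Type} [AddCommGroup X] [Module R X] (x : X) :
    x ∈ gam (b ⊔ Ideal.span {f}) X ↔ x ∈ gam b X ∧ ∃ n : ℕ, f ^ n • x = 0 := by
  constructor
  · rintro ⟨t, ht⟩
    refine ⟨⟨t, fun r hr => ht r (Ideal.pow_right_mono le_sup_left _ hr)⟩, t, ht _ ?_⟩
    exact Ideal.pow_mem_pow (Ideal.mem_sup_right (Ideal.mem_span_singleton_self f)) t
  · rintro ⟨⟨t, ht⟩, n, hn⟩
    refine ⟨t + n, fun r hr => ?_⟩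
    have := Ideal.sup_pow_add_le_pow_sup_pow hr
    rw [Ideal.span_singleton_pow] at this
    obtain ⟨y, hy, z, hz, rfl⟩ := Submodule.mem_sup.1 this
    obtain ⟨c, rfl⟩ := Ideal.mem_span_singleton'.1 hz
    rw [add_smul, ht y hy, mul_smul, hn, smul_zero, add_zero]

end partfive

section partsix
variable {R : Type} [CommRing R]

theorem exists_ses (X : ModuleCat.{0} R) : ∃ S : ShortComplex (ModuleCat.{0} R),
    S.ShortExact ∧ Injective S.X₂ ∧ S.X₁ = X := by
  refine ⟨ShortComplex.mk (Injective.ι X) (cokernel.π (Injective.ι X)) (cokernel.condition _),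
    ?_, ?_, rfl⟩
  · exact ShortComplex.ShortExact.mk' (ShortComplex.exact_cokernel _) (inferInstanceAs (Mono (Injective.ι X)))
      (inferInstanceAs (Epi (cokernel.π (Injective.ι X))))
  · exact inferInstanceAs (Injective (Injective.under X))

/-- Restriction to torsion. -/
def gamMap (b : Ideal R) {X Y : Type} [AddCommGroup X] [Module R X] [AddCommGroup Y] [Module R Y]
    (g : X →ₗ[R] Y) : gam b X →ₗ[R] gam b Y :=
  g.restrict (fun x ⟨t, ht⟩ => ⟨t, fun r hr => by rw [← map_smul, ht r hr, map_zero]⟩)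

theorem gamMap_coe (b : Ideal R) {X Y : Type} [AddCommGroup X] [Module R X] [AddCommGroup Y]
    [Module R Y] (g : X →ₗ[R] Y) (x : gam b X) : (gamMap b g x : Y) = g x := rfl

variable [IsNoetherianRing R]

theorem gamMap_surj (b : Ideal R) (S : ShortComplex (ModuleCat.{0} R)) (hS : S.ShortExact)
    [Injective S.X₂] (h : Subsingleton ((localCohomology b 1).obj S.X₁)) :
    Function.Surjective (gamMap b S.g.hom) := by
  obtain ⟨q, -, hq⟩ := lcS1 b S hS
  intro y
  obtain ⟨x, hx, hxy⟩ := (hq y).1 (Subsingleton.elim _ _)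
  exact ⟨⟨x, hx⟩, Subtype.ext hxy⟩

theorem gamMap_exact (b : Ideal R) (S : ShortComplex (ModuleCat.{0} R)) (hS : S.ShortExact) :
    Function.Exact (gamMap b S.f.hom) (gamMap b S.g.hom) := by
  have hinj : Function.Injective S.f.hom := (ModuleCat.mono_iff_injective _).1 hS.mono_f
  intro y
  constructor
  · intro hy
    have hy' : S.g (y : S.X₂) = 0 := congrArg Subtype.val hy
    obtain ⟨x, hx⟩ := (ShortComplex.moduleCat_exact_iff _).1 hS.exact _ hy'
    obtain ⟨t, ht⟩ := y.2
    refine ⟨⟨x, t, fun r hr => hinj ?_⟩, Subtype.ext hx⟩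
    rw [map_smul, map_zero]
    exact (congrArg (r • ·) hx).trans (ht r hr)
  · rintro ⟨x, rfl⟩
    apply Subtype.ext
    exact congrArg (fun t => t.hom (x : S.X₁)) S.zero

theorem gamMap_inj (b : Ideal R) (S : ShortComplex (ModuleCat.{0} R)) (hS : S.ShortExact) :
    Function.Injective (gamMap b S.f.hom) := by
  have hinj : Function.Injective S.f.hom := (ModuleCat.mono_iff_injective _).1 hS.mono_f
  intro x y h
  exact Subtype.ext (hinj (congrArg Subtype.val h))

theorem key_one (b : Ideal R) (f : R) (X : ModuleCat.{0} R)
    (h : Subsingleton ((localCohomology b 1).obj X)) :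
    Nonempty ((localCohomology (b ⊔ Ideal.span {f}) 1).obj X ≃ₗ[R] Cf f (gam b X)) := by
  obtain ⟨S, hS, hI, rfl⟩ := exists_ses X
  obtain ⟨q, hq, hq0⟩ := lcS1 (b ⊔ Ideal.span {f}) S hS
  obtain ⟨p, hp, hp0⟩ := snakeCf f (gamMap b S.f.hom) (gamMap b S.g.hom) (gamMap_exact b S hS)
    (gamMap_inj b S hS) (gamMap_surj b S hS h) (fdiv_gam_injective b f S.X₂)
  let j : gam (b ⊔ Ideal.span {f}) S.X₃ →ₗ[R] LinearMap.ker (mkL f (gam b S.X₃)) :=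
    { toFun := fun x => ⟨⟨x, ((mem_gam_sup b f _).1 x.2).1⟩, by
        rw [LinearMap.mem_ker, mkL_eq_zero]
        obtain ⟨n, hn⟩ := ((mem_gam_sup b f _).1 x.2).2
        exact ⟨n, Subtype.ext hn⟩⟩
      map_add' := fun _ _ => rfl
      map_smul' := fun _ _ => rfl }
  have hj : Function.Surjective j := by
    rintro ⟨⟨x, hx⟩, hx2⟩
    rw [LinearMap.mem_ker, mkL_eq_zero] at hx2
    obtain ⟨n, hn⟩ := hx2
    exact ⟨⟨x, (mem_gam_sup b f _).2 ⟨hx, n, congrArg Subtype.val hn⟩⟩, rfl⟩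
  refine iso_of_ker q (p ∘ₗ j) hq (hp.comp hj) (fun y => ?_)
  rw [hq0, LinearMap.comp_apply, hp0]
  constructor
  · rintro ⟨x, hx, hxy⟩
    obtain ⟨h1, n, hn⟩ := (mem_gam_sup b f _).1 hx
    refine ⟨⟨x, h1⟩, (mkL_eq_zero f _).2 ⟨n, Subtype.ext hn⟩, Subtype.ext hxy⟩
  · rintro ⟨x, hx, hxy⟩
    obtain ⟨n, hn⟩ := (mkL_eq_zero f _).1 hx
    exact ⟨x, (mem_gam_sup b f _).2 ⟨x.2, n, congrArg Subtype.val hn⟩, congrArg Subtype.val hxy⟩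

theorem shift_vanish (b : Ideal R) (S : ShortComplex (ModuleCat.{0} R)) (hS : S.ShortExact)
    [Injective S.X₂] (i : ℕ) : Subsingleton ((localCohomology b (i+2)).obj S.X₁) ↔
      Subsingleton ((localCohomology b (i+1)).obj S.X₃) := by
  obtain ⟨e⟩ := lcS2 b S hS i
  exact e.toLinearEquiv.toEquiv.subsingleton_congr

theorem key_vanish (b : Ideal R) (f : R) (i : ℕ) : ∀ (X : ModuleCat.{0} R)
    (_ : ∀ i > 0, Subsingleton ((localCohomology b i).obj X)) (_ : fdiv f (gam b X)),
    Subsingleton ((localCohomology (b ⊔ Ideal.span {f}) (i+1)).obj X) := by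
  induction i with
  | zero =>
    intro X h hd
    obtain ⟨e⟩ := key_one b f X (h 1 (by omega))
    have := Cf_subsingleton hd
    exact e.toEquiv.subsingleton
  | succ i ih =>
    intro X h hd
    obtain ⟨S, hS, hI, rfl⟩ := exists_ses X
    rw [show i + 1 + 1 = i + 2 from rfl, shift_vanish _ S hS i]
    refine ih S.X₃ (fun k hk => ?_) ?_
    · obtain ⟨k, rfl⟩ : ∃ l, k = l + 1 := ⟨k - 1, by omega⟩
      rw [← shift_vanish _ S hS]
      exact h _ (by omega)
    · exact fdiv_of_surj _ (gamMap_surj b S hS (h 1 (by omega))) (fdiv_gam_injective b f S.X₂)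

theorem key (b : Ideal R) (f : R) (d : ℕ) : ∀ (X : ModuleCat.{0} R)
    (_ : ∀ i > d, Subsingleton ((localCohomology b i).obj X)),
    (∀ i > d + 1, Subsingleton ((localCohomology (b ⊔ Ideal.span {f}) i).obj X)) ∧
    Nonempty ((localCohomology (b ⊔ Ideal.span {f}) (d+1)).obj X ≃ₗ[R]
      Cf f ((localCohomology b d).obj X)) := by
  induction d with
  | zero =>
    intro X h
    constructor
    · intro i hi
      obtain ⟨S, hS, hI, rfl⟩ := exists_ses X
      obtain ⟨i, rfl⟩ : ∃ l, i = l + 2 := ⟨i - 2, by omega⟩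
      rw [shift_vanish _ S hS i]
      apply key_vanish
      · intro k hk
        obtain ⟨k, rfl⟩ : ∃ l, k = l + 1 := ⟨k - 1, by omega⟩
        rw [← shift_vanish _ S hS]
        exact h _ (by omega)
      · exact fdiv_of_surj _ (gamMap_surj b S hS (h 1 (by omega)))
          (fdiv_gam_injective b f S.X₂)
    · obtain ⟨e⟩ := key_one b f X (h 1 (by omega))
      obtain ⟨z⟩ := lcZ b X
      obtain ⟨c⟩ := Cf_congr f z
      exact ⟨e.trans c.symm⟩
  | succ d ih =>
    intro X h
    obtain ⟨S, hS, hI, rfl⟩ := exists_ses X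
    have hY : ∀ i > d, Subsingleton ((localCohomology b i).obj S.X₃) := by
      intro k hk
      obtain ⟨k, rfl⟩ : ∃ l, k = l + 1 := ⟨k - 1, by omega⟩
      rw [← shift_vanish _ S hS]
      exact h _ (by omega)
    obtain ⟨h1, ⟨e⟩⟩ := ih S.X₃ hY
    constructor
    · intro i hi
      obtain ⟨i, rfl⟩ : ∃ l, i = l + 2 := ⟨i - 2, by omega⟩
      rw [shift_vanish _ S hS i]
      exact h1 _ (by omega)
    · obtain ⟨e1⟩ := lcS2 (b ⊔ Ideal.span {f}) S hS d
      rcases d with _ | d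
      · obtain ⟨z⟩ := lcZ b S.X₃
        obtain ⟨c⟩ := Cf_congr f z
        obtain ⟨q, hq, hq0⟩ := lcS1 b S hS
        obtain ⟨c2⟩ := Cf_iso_of_exact f (gamMap b S.g.hom) q (by
          intro y
          rw [hq0]
          constructor
          · rintro ⟨x, hx, hxy⟩
            exact ⟨⟨x, hx⟩, Subtype.ext hxy⟩
          · rintro ⟨x, rfl⟩
            exact ⟨x, x.2, rfl⟩) hq (fdiv_gam_injective b f S.X₂)
        exact ⟨e1.toLinearEquiv.trans (e.trans (c.trans c2))⟩
      · obtain ⟨e2⟩ := lcS2 b S hS d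
        obtain ⟨c⟩ := Cf_congr f e2.toLinearEquiv
        exact ⟨e1.toLinearEquiv.trans (e.trans c.symm)⟩

/-- Iterated `Cf`. -/
noncomputable def CC : List R → ModuleCat.{0} R → ModuleCat.{0} R
  | [], M => M
  | f :: l, M => ModuleCat.of R (Cf f (CC l M))

theorem CC_congr (l : List R) {M N : ModuleCat.{0} R} (e : M ≃ₗ[R] N) :
    Nonempty (CC l M ≃ₗ[R] CC l N) := by
  induction l with
  | nil => exact ⟨e⟩
  | cons f l ih =>
    obtain ⟨e'⟩ := ih
    exact Cf_congr f e'

theorem key_list (b : Ideal R) (X : ModuleCat.{0} R) (d : ℕ)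
    (h : ∀ i > d, Subsingleton ((localCohomology b i).obj X)) (l : List R) :
    (∀ i > d + l.length, Subsingleton
      ((localCohomology (b ⊔ Ideal.span {x | x ∈ l}) i).obj X)) ∧
    Nonempty ((localCohomology (b ⊔ Ideal.span {x | x ∈ l}) (d + l.length)).obj X ≃ₗ[R]
      CC l ((localCohomology b d).obj X)) := by
  induction l with
  | nil =>
    have : b ⊔ Ideal.span {x : R | x ∈ ([] : List R)} = b := by simp
    rw [this]
    exact ⟨h, ⟨LinearEquiv.refl _ _⟩⟩
  | cons f l ih =>
    have : b ⊔ Ideal.span {x | x ∈ f :: l} =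
        (b ⊔ Ideal.span {x | x ∈ l}) ⊔ Ideal.span {f} := by
      rw [sup_assoc, ← Ideal.span_union]
      congr 2
      ext x
      simp [or_comm]
    rw [this]
    obtain ⟨h1, ⟨e⟩⟩ := ih
    obtain ⟨h2, ⟨e2⟩⟩ := key _ f _ X h1
    refine ⟨h2, ?_⟩
    obtain ⟨c⟩ := Cf_congr f e
    exact ⟨e2.trans c⟩

theorem lc_congr {J K : Ideal R} (h : J.radical = K.radical) (i : ℕ) (X : ModuleCat.{0} R) :
    Nonempty ((localCohomology J i).obj X ≃ₗ[R] (localCohomology K i).obj X) :=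
  ⟨((localCohomology.isoOfSameRadical h i).app X).toLinearEquiv⟩

theorem lc_bot (X : ModuleCat.{0} R) :
    Nonempty ((localCohomology (⊥ : Ideal R) 0).obj X ≃ₗ[R] X) := by
  obtain ⟨e⟩ := lcZ (⊥ : Ideal R) X
  exact ⟨e.trans (LinearEquiv.ofTop _ (gam_bot X))⟩

theorem main_sub (a b : Ideal R) (X : ModuleCat.{0} R) (d : ℕ)
    (h : ∀ i > d, Subsingleton ((localCohomology b i).obj X)) (l : List R)
    (hl : (Ideal.span {x | x ∈ l}).radical = a.radical) :
    (∀ i > d + l.length, Subsingleton ((localCohomology (a + b) i).obj X)) ∧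
    Nonempty ((localCohomology (a + b) (d + l.length)).obj X ≃ₗ[R]
      CC l ((localCohomology b d).obj X)) := by
  obtain ⟨h1, ⟨e⟩⟩ := key_list b X d h l
  have hr : (a + b).radical = (b ⊔ Ideal.span {x | x ∈ l}).radical := by
    rw [Ideal.add_eq_sup, Ideal.radical_sup, Ideal.radical_sup b, hl, sup_comm]
  constructor
  · intro i hi
    obtain ⟨e'⟩ := lc_congr hr i X
    have := h1 i hi
    exact e'.toEquiv.subsingleton
  · obtain ⟨e'⟩ := lc_congr hr (d + l.length) X
    exact ⟨e'.trans e⟩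

theorem main_sub0 (a : Ideal R) (X : ModuleCat.{0} R) (l : List R)
    (hl : (Ideal.span {x | x ∈ l}).radical = a.radical) :
    (∀ i > l.length, Subsingleton ((localCohomology a i).obj X)) ∧
    Nonempty ((localCohomology a l.length).obj X ≃ₗ[R] CC l X) := by
  obtain ⟨h1, ⟨e⟩⟩ := main_sub a ⊥ X 0 (fun i hi => by
    obtain ⟨i, rfl⟩ : ∃ l, i = l + 1 := ⟨i - 1, by omega⟩
    exact lcBotSucc X i) l hl
  rw [Ideal.add_eq_sup, sup_bot_eq] at e h1
  rw [zero_add] at e h1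
  obtain ⟨e1⟩ := lc_bot X
  obtain ⟨c⟩ := CC_congr l e1
  exact ⟨h1, ⟨e.trans c⟩⟩

theorem exists_list (a : Ideal R) : ∃ l : List R, l.length = araRank a ∧
    (Ideal.span {x | x ∈ l}).radical = a.radical := by
  have hne : {n : ℕ | ∃ f : Fin n → R, (Ideal.span (Set.range f)).radical = a.radical}.Nonempty := by
    obtain ⟨n, f, hf⟩ := Submodule.fg_iff_exists_fin_generating_family.1
      (IsNoetherian.noetherian a : a.FG)
    exact ⟨n, f, congrArg Ideal.radical hf⟩
  obtain ⟨f, hf⟩ := Nat.sInf_mem hne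
  refine ⟨List.ofFn f, List.length_ofFn, ?_⟩
  refine Eq.trans ?_ hf
  congr 2
  ext x
  simp [List.mem_ofFn]

theorem cohDim_bdd (a : Ideal R) (X : ModuleCat.{0} R) :
    BddAbove {i : ℕ | Nontrivial ((localCohomology a i).obj X)} := by
  obtain ⟨l, -, hl⟩ := exists_list a
  refine ⟨l.length, fun i hi => ?_⟩
  by_contra hlt
  have := (main_sub0 a X l hl).1 i (by omega)
  exact not_subsingleton_iff_nontrivial.2 hi this

theorem cohDim_vanish (a : Ideal R) (X : ModuleCat.{0} R) (i : ℕ) (hi : i > cohDim a X) :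
    Subsingleton ((localCohomology a i).obj X) := by
  by_contra h
  have := le_csSup (cohDim_bdd a X) (not_subsingleton_iff_nontrivial.1 h)
  exact absurd this (not_le.2 hi)

theorem cohDim_eq_iff (a : Ideal R) (X : ModuleCat.{0} R) (n : ℕ)
    (h : ∀ i > n, Subsingleton ((localCohomology a i).obj X)) :
    cohDim a X = n ↔ (n = 0 ∨ Nontrivial ((localCohomology a n).obj X)) := by
  have hle : cohDim a X ≤ n := by
    by_contra hlt
    have hne : {i : ℕ | Nontrivial ((localCohomology a i).obj X)}.Nonempty := by
      by_contra hne
      rw [Set.not_nonempty_iff_eq_empty] at hne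
      rw [cohDim, hne] at hlt
      simp at hlt
    have hm : Nontrivial ((localCohomology a (cohDim a X)).obj X) :=
      Nat.sSup_mem hne (cohDim_bdd a X)
    exact not_subsingleton_iff_nontrivial.2 hm (h _ (by omega))
  constructor
  · intro he
    by_cases hn : n = 0
    · exact Or.inl hn
    · right
      have hne : {i : ℕ | Nontrivial ((localCohomology a i).obj X)}.Nonempty := by
        by_contra hne
        rw [Set.not_nonempty_iff_eq_empty] at hne
        rw [cohDim, hne] at he
        simp at he
        omega
      have hm : Nontrivial ((localCohomology a (cohDim a X)).obj X) :=
        Nat.sSup_mem hne (cohDim_bdd a X)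
      rwa [he] at hm
  · rintro (rfl | hn)
    · omega
    · exact le_antisymm hle (le_csSup (cohDim_bdd a X) hn)

end partsix

/-- Let `R` be a commutative noetherian ring, `a, b` ideals of `R` and `X` an
arbitrary `R`-module.  Then `H^{ara(a)+cd(b,X)}_{a+b}(X) ≅ H^{ara(a)}_a(H^{cd(b,X)}_b(X))`;
moreover `cd(a+b, X) = ara(a) + cd(b, X)` iff `ara(a) = cd(a, H^{cd(b,X)}_b(X))`. -/
theorem statement9 {R : Type} [CommRing R] [IsNoetherianRing R] (a b : Ideal R)
    (X : ModuleCat R) :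
    Nonempty ((localCohomology (a + b) (araRank a + cohDim b X)).obj X ≅
      (localCohomology a (araRank a)).obj ((localCohomology b (cohDim b X)).obj X)) ∧
    (cohDim (a + b) X = araRank a + cohDim b X ↔
      araRank a = cohDim a ((localCohomology b (cohDim b X)).obj X)) := by
  obtain ⟨l, hn, hl⟩ := exists_list a
  obtain ⟨h1, ⟨e1⟩⟩ := main_sub a b X (cohDim b X) (cohDim_vanish b X) l hl
  obtain ⟨h2, ⟨e2⟩⟩ := main_sub0 a ((localCohomology b (cohDim b X)).obj X) l hl
  rw [hn] at h1 h2 e1 e2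
  rw [add_comm (cohDim b X)] at h1 e1
  have e := e1.trans e2.symm
  refine ⟨⟨e.toModuleIso⟩, ?_⟩
  rw [cohDim_eq_iff _ _ _ h1, eq_comm (a := araRank a), cohDim_eq_iff _ _ _ h2,
    e.toEquiv.nontrivial_congr]
  constructor
  · rintro (h | h)
    · left; omega
    · right; exact h
  · rintro (h | h)
    · by_cases hd : cohDim b X = 0
      · left; omega
      · right
        have hb := (cohDim_eq_iff b X _ (cohDim_vanish b X)).1 rfl
        have hnt := hb.resolve_left hd
        have hl0 : l = [] := List.length_eq_zero_iff.1 (hn.trans h)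
        subst hl0
        exact e2.toEquiv.nontrivial_congr.2 hnt
    · right; exact h
end
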